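/- Let q ≥ 2 be an integer and β > q, let a be the unique fixed point of F in (1/q, 1], and set θ := (aq − 1)/(q − 1). Let A be distributed according to the random-cluster measure π on the complete graph on n vertices with parameters q and p = 1 − e^{−β/n}. Then there exist constants γ₀, γ₁ > 0 such that for all sufficiently large n, with probability at least 0.9, both |L₁(A) − θn| ≤ γ₀√n and Σ_{i≥2} L_i(A)² ≤ γ₁·n. -/

import Mathlib

open scoped Classical
open Finset

/-- Spin configurations on `n` vertices with `q` spins. -/
abbrev Conf (n q : ℕ) := Fin n → Fin q

/-- Number of vertices assigned spin `j`. -/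
def cntN {n q : ℕ} (X : Conf n q) (j : Fin q) : ℕ :=
  (Finset.univ.filter (fun v => X v = j)).card

/-- Number of monochromatic pairs `{u,v}` (`u < v`, same spin). -/
def numMono {n q : ℕ} (σ : Conf n q) : ℕ :=
  (Finset.univ.filter (fun p : Fin n × Fin n => p.1 < p.2 ∧ σ p.1 = σ p.2)).card

/-- The mean-field `q`-state Potts measure: probability of `σ`. -/
noncomputable def pottsProb (n q : ℕ) (β : ℝ) (σ : Conf n q) : ℝ :=
  Real.exp (β / n * numMono σ) / ∑ τ : Conf n q, Real.exp (β / n * numMono τ)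

/-- The set of monochromatic pairs of a configuration. -/
def monoPairs {n q : ℕ} (σ : Conf n q) : Finset (Fin n × Fin n) :=
  Finset.univ.filter (fun p : Fin n × Fin n => p.1 < p.2 ∧ σ p.1 = σ p.2)

/-- The graph on `Fin n` whose edges are the pairs in `E`. -/
def graphOf {n : ℕ} (E : Finset (Fin n × Fin n)) : SimpleGraph (Fin n) :=
  SimpleGraph.fromRel (fun u v => (u, v) ∈ E)

/-- Number of connected components of the graph `(V, E)`. -/
noncomputable def numComps {n : ℕ} (E : Finset (Fin n × Fin n)) : ℕ :=
  Nat.card (graphOf E).ConnectedComponent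

/-- One-step transition probability of the Swendsen–Wang dynamics:
percolate on monochromatic pairs with probability `p = 1 - exp (-β/n)`,
then color each connected component uniformly at random. -/
noncomputable def swStep (n q : ℕ) (β : ℝ) (σ τ : Conf n q) : ℝ :=
  ∑ E ∈ (monoPairs σ).powerset,
    ((1 - Real.exp (-(β / n))) ^ E.card *
        Real.exp (-(β / n)) ^ ((monoPairs σ).card - E.card)) *
      (if ∀ u v : Fin n, (graphOf E).Reachable u v → τ u = τ v then
        ((q : ℝ))⁻¹ ^ numComps E else 0)

/-- `t`-step transition probability of the Swendsen–Wang dynamics. -/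
noncomputable def swProb (n q : ℕ) (β : ℝ) : ℕ → Conf n q → Conf n q → ℝ
  | 0, σ, τ => if σ = τ then 1 else 0
  | t + 1, σ, τ => ∑ η : Conf n q, swStep n q β σ η * swProb n q β t η τ

/-- Probability of observing the trajectory `ω 0, ω 1, …, ω (ℓ-1)` at times
`1, …, ℓ` for the SW dynamics started at `X₀`. -/
noncomputable def pathProb (n q : ℕ) (β : ℝ) (X₀ : Conf n q) (ℓ : ℕ)
    (ω : Fin ℓ → Conf n q) : ℝ :=
  ∏ i : Fin ℓ, swStep n q β
    (if _h : 0 < (i : ℕ) then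
        ω ⟨(i : ℕ) - 1, lt_of_le_of_lt (Nat.sub_le _ _) i.isLt⟩
      else X₀) (ω i)

/-- Total variation distance between two probability vectors on configurations. -/
noncomputable def tvDist {n q : ℕ} (f g : Conf n q → ℝ) : ℝ :=
  (∑ τ : Conf n q, |f τ - g τ|) / 2

/-- Mixing time `τ_mix(ε)` of the SW dynamics. -/
noncomputable def mixingTime (n q : ℕ) (β ε : ℝ) : ℕ :=
  sInf {t : ℕ | ∀ σ : Conf n q, tvDist (swProb n q β t σ) (pottsProb n q β) ≤ ε}

/-- `theta lam` is the unique root in `(0,1)` of `exp (-lam * x) = 1 - x`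
for `lam > 1`, and `0` for `lam ≤ 1`. -/
noncomputable def theta (lam : ℝ) : ℝ :=
  if lam ≤ 1 then 0
  else sSup {x : ℝ | x ∈ Set.Ioo (0 : ℝ) 1 ∧ Real.exp (-lam * x) = 1 - x}

/-- The drift function `F`. -/
noncomputable def F (q : ℕ) (β : ℝ) (x : ℝ) : ℝ :=
  1 / q + (1 - 1 / q) * theta (β * x) * x

/-- The unique fixed point of `F` in `(1/q, 1]` (for `β > q`). -/
noncomputable def aFix (q : ℕ) (β : ℝ) : ℝ :=
  sSup {x : ℝ | x ∈ Set.Ioc (1 / (q : ℝ)) 1 ∧ F q β x = x}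

/-- The cutoff constant `c(β,q) = (2 log (1 / F'(a)))⁻¹`. -/
noncomputable def cConst (q : ℕ) (β : ℝ) : ℝ :=
  (2 * Real.log (1 / deriv (F q β) (aFix q β)))⁻¹

/-- Fraction of vertices assigned spin `j`. -/
noncomputable def cntFrac {n q : ℕ} (X : Conf n q) : Fin q → ℝ :=
  fun j => (cntN X j : ℝ) / n

/-- The proportions vector `α(X)`: fractions of vertices of each spin,
sorted in nonincreasing order. -/
noncomputable def alphaVec {n q : ℕ} (X : Conf n q) : Fin q → ℝ :=
  fun i => cntFrac X (Tuple.sort (cntFrac X) i.rev)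

/-- `ℓ∞` distance between two vectors indexed by `Fin q`. -/
noncomputable def linf {q : ℕ} (f g : Fin q → ℝ) : ℝ :=
  ⨆ i : Fin q, |f i - g i|

/-- The vector `κ(b) = (b, (1-b)/(q-1), …, (1-b)/(q-1))`. -/
noncomputable def kappaVec (q : ℕ) (b : ℝ) : Fin q → ℝ :=
  fun i => if (i : ℕ) = 0 then b else (1 - b) / ((q : ℝ) - 1)

/-- The majority vector `m = (a, (1-a)/(q-1), …, (1-a)/(q-1))`. -/
noncomputable def mVec (q : ℕ) (β : ℝ) : Fin q → ℝ :=
  kappaVec q (aFix q β)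

/-- Index of the most common spin of `X` (least such index on ties). -/
noncomputable def domIdx {n q : ℕ} (X : Conf n q) : ℕ :=
  sInf {j : ℕ | ∃ hj : j < q, ∀ j' : Fin q, cntN X j' ≤ cntN X ⟨j, hj⟩}

/-- `α₁(X)`: fraction of vertices carrying the most common spin of `X`. -/
noncomputable def alpha1 {n q : ℕ} (X : Conf n q) : ℝ :=
  ((Finset.univ.filter (fun v : Fin n => (X v : ℕ) = domIdx X)).card : ℝ) / n

/-- `α_{1,k}(X)`: fraction of vertices of `Vk` carrying the most common spin of `X`. -/
noncomputable def alpha1In {n q : ℕ} (X : Conf n q) (Vk : Finset (Fin n)) : ℝ :=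
  ((Vk.filter (fun v => (X v : ℕ) = domIdx X)).card : ℝ) / Vk.card

/-- `P` is a partition of the vertex set into `q` classes. -/
def IsPartition {n q : ℕ} (P : Fin q → Finset (Fin n)) : Prop :=
  (∀ i j, i ≠ j → Disjoint (P i) (P j)) ∧ ∀ v : Fin n, ∃ i, v ∈ P i

/-- A `λ`-partition: a partition with all classes of size at least `λ n`. -/
def IsLamPartition {n q : ℕ} (lam : ℝ) (P : Fin q → Finset (Fin n)) : Prop :=
  IsPartition P ∧ ∀ i, lam * n ≤ ((P i).card : ℝ)

/-- Projection: `projCnt P X i j` is the number of vertices of `P i`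
assigned spin `j` in `X`. -/
def projCnt {n q : ℕ} (P : Fin q → Finset (Fin n)) (X : Conf n q) :
    Fin q → Fin q → ℕ :=
  fun i j => ((P i).filter (fun v => X v = j)).card

/-- All potential edges of the complete graph on `Fin n`. -/
def allPairs (n : ℕ) : Finset (Fin n × Fin n) :=
  Finset.univ.filter (fun p : Fin n × Fin n => p.1 < p.2)

/-- Probability of the edge set `E` under the Erdős–Rényi measure `G(n,p)`. -/
noncomputable def erProb (n : ℕ) (p : ℝ) (E : Finset (Fin n × Fin n)) : ℝ :=
  p ^ E.card * (1 - p) ^ ((allPairs n).card - E.card)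

/-- Size of the connected component of `v` in the graph `(V, E)`. -/
noncomputable def compCard {n : ℕ} (E : Finset (Fin n × Fin n)) (v : Fin n) : ℕ :=
  (Finset.univ.filter (fun u => (graphOf E).Reachable v u)).card

/-- `L₁`: size of the largest connected component. -/
noncomputable def L1 {n : ℕ} (E : Finset (Fin n × Fin n)) : ℕ :=
  Finset.univ.sup (fun v => compCard E v)

/-- Sum of the squares of the component sizes, `Σ_j L_j²`
(computed as `Σ_v |C(v)|`). -/
noncomputable def sumCompSq {n : ℕ} (E : Finset (Fin n × Fin n)) : ℕ :=
  ∑ v : Fin n, compCard E v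

/-- Expectation of `f` under the Erdős–Rényi measure `G(n,p)`. -/
noncomputable def erExp (n : ℕ) (p : ℝ) (f : Finset (Fin n × Fin n) → ℝ) : ℝ :=
  ∑ E ∈ (allPairs n).powerset, erProb n p E * f E

/-- Random-cluster weight of an edge set with parameters `q`, `p = 1 - exp (-β/n)`. -/
noncomputable def rcWeight (n q : ℕ) (β : ℝ) (E : Finset (Fin n × Fin n)) : ℝ :=
  (1 - Real.exp (-(β / n))) ^ E.card *
    Real.exp (-(β / n)) ^ ((allPairs n).card - E.card) * (q : ℝ) ^ numComps E

/-- The mean-field random-cluster measure: probability of the edge set `E`. -/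
noncomputable def rcProb (n q : ℕ) (β : ℝ) (E : Finset (Fin n × Fin n)) : ℝ :=
  rcWeight n q β E / ∑ B ∈ (allPairs n).powerset, rcWeight n q β B

/-- The gap equation: `gapFun q β d = 0` says that `d` is the difference of the two coordinate
values of an ordered critical point of the mean-field Potts functional. -/
noncomputable def gapFun (q β d : ℝ) : ℝ :=
  β * (1 - Real.exp (-d)) - d - (q - 1) * d * Real.exp (-d)

theorem hasDerivAt_gapFun (q β d : ℝ) :
    HasDerivAt (gapFun q β)
      (Real.exp (-d) * (β - (q - 1) + (q - 1) * d - Real.exp d)) d := by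
  have h1 : HasDerivAt (fun x : ℝ => Real.exp (-x)) (-Real.exp (-d)) d := by
    simpa using (hasDerivAt_neg d).exp
  have h := ((((h1.const_sub 1).const_mul β).sub (hasDerivAt_id' d)).sub
    (((hasDerivAt_id' d).const_mul (q - 1)).mul h1))
  refine (h.congr_deriv ?_)
  have : Real.exp (-d) * Real.exp d = 1 := by rw [← Real.exp_add]; simp
  linear_combination this

theorem gapFun_zero (q β : ℝ) : gapFun q β 0 = 0 := by simp [gapFun]

theorem gapDeriv_pos_of_lt {q β c d : ℝ} (hβ : q < β) (hc : 0 < c) (hcd : c < d)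
    (hd : 0 ≤ β - (q - 1) + (q - 1) * d - Real.exp d) :
    0 < β - (q - 1) + (q - 1) * c - Real.exp c := by
  have hd0 : 0 < d := hc.trans hcd
  have h := convexOn_exp.2 (Set.mem_univ (0 : ℝ)) (Set.mem_univ d)
    (sub_nonneg.2 ((div_le_one hd0).2 hcd.le)) (div_nonneg hc.le hd0.le) (by ring)
  simp only [smul_eq_mul, mul_zero, zero_add, Real.exp_zero, mul_one] at h
  have hcd' : c / d * d = c := div_mul_cancel₀ _ hd0.ne'
  rw [hcd'] at h
  have h1 : 0 < 1 - c / d := sub_pos.2 ((div_lt_one hd0).2 hcd)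
  have h2 : 0 ≤ c / d := div_nonneg hc.le hd0.le
  have h3 := mul_nonneg h2 hd
  have h4 := mul_pos h1 (sub_pos.2 hβ)
  have h5 : c / d * ((q - 1) * d) = (q - 1) * c := by rw [← hcd']; ring_nf; field_simp
  nlinarith

theorem exists_gapDeriv_eq_zero {q β x y : ℝ} (hxy : x < y) (h : gapFun q β x = gapFun q β y) :
    ∃ c ∈ Set.Ioo x y, β - (q - 1) + (q - 1) * c - Real.exp c = 0 := by
  obtain ⟨c, hc, h0⟩ := exists_hasDerivAt_eq_zero hxy
    (fun z _ => (hasDerivAt_gapFun q β z).continuousAt.continuousWithinAt) h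
    (fun z _ => hasDerivAt_gapFun q β z)
  exact ⟨c, hc, (mul_eq_zero.1 h0).resolve_left (Real.exp_pos _).ne'⟩

theorem gapDeriv_neg {q β d : ℝ} (hβ : q < β) (hd : 0 < d) (h : gapFun q β d = 0) :
    β - (q - 1) + (q - 1) * d - Real.exp d < 0 := by
  obtain ⟨c, hc, h0⟩ := exists_gapDeriv_eq_zero hd ((gapFun_zero q β).trans h.symm)
  by_contra! hneg
  exact (gapDeriv_pos_of_lt hβ hc.1 hc.2 hneg).ne' h0

theorem gapFun_root_unique {q β d e : ℝ} (hβ : q < β) (hd : 0 < d) (he : 0 < e)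
    (h : gapFun q β d = 0) (h' : gapFun q β e = 0) : d = e := by
  have key : ∀ x y : ℝ, 0 < x → x < y → gapFun q β x = 0 → gapFun q β y = 0 → False := by
    intro x y hx hxy h1 h2
    obtain ⟨c, hc, hc0⟩ := exists_gapDeriv_eq_zero hx ((gapFun_zero q β).trans h1.symm)
    obtain ⟨c', hc', hc0'⟩ := exists_gapDeriv_eq_zero hxy (h1.trans h2.symm)
    exact (gapDeriv_pos_of_lt hβ hc.1 (hc.2.trans hc'.1) hc0'.ge).ne' hc0
  rcases lt_trichotomy d e with hlt | heq | hlt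
  · exact (key d e hd hlt h h').elim
  · exact heq
  · exact (key e d he hlt h' h).elim

theorem exp_root_unique {lam x y : ℝ} (hx : 0 < x) (hy : 0 < y)
    (h : Real.exp (-lam * x) = 1 - x) (h' : Real.exp (-lam * y) = 1 - y) (hlam : lam ≠ 0) :
    x = y := by
  have key : ∀ x y : ℝ, 0 < x → x < y → Real.exp (-lam * x) = 1 - x →
      Real.exp (-lam * y) = 1 - y → False := by
    intro x y hx hxy h h'
    have hy0 : 0 < y := hx.trans hxy
    have hne : (0 : ℝ) ≠ -lam * y := (mul_ne_zero (neg_ne_zero.2 hlam) hy0.ne').symm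
    have hs := strictConvexOn_exp.2 (Set.mem_univ (0 : ℝ)) (Set.mem_univ (-lam * y)) hne
      (sub_pos.2 ((div_lt_one hy0).2 hxy)) (div_pos hx hy0) (by ring)
    simp only [smul_eq_mul, mul_zero, zero_add, Real.exp_zero, mul_one] at hs
    rw [h', show x / y * (-lam * y) = -lam * x by field_simp, h] at hs
    have : x / y * (1 - y) = x / y - x := by field_simp
    linarith
  rcases lt_trichotomy x y with hlt | heq | hlt
  · exact (key x y hx hlt h h').elim
  · exact heq
  · exact (key y x hy hlt h' h).elim

theorem theta_eq {lam x : ℝ} (hlam : 1 < lam) (hx0 : 0 < x) (hx1 : x < 1)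
    (h : Real.exp (-lam * x) = 1 - x) : theta lam = x := by
  have hset : {y : ℝ | y ∈ Set.Ioo (0 : ℝ) 1 ∧ Real.exp (-lam * y) = 1 - y} = {x} := by
    ext y
    simp only [Set.mem_ofPred_eq, Set.mem_singleton_iff, Set.mem_Ioo]
    refine ⟨fun hy => exp_root_unique hy.1.1 hx0 hy.2 h (by positivity), ?_⟩
    rintro rfl
    exact ⟨⟨hx0, hx1⟩, h⟩
  rw [theta, if_neg (not_le.2 hlam), hset, csSup_singleton]

theorem theta_spec {lam : ℝ} (h : theta lam ≠ 0) :
    0 < theta lam ∧ theta lam < 1 ∧ Real.exp (-lam * theta lam) = 1 - theta lam := by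
  have hlam : 1 < lam := by
    by_contra! hle
    exact h (by rw [theta, if_pos hle])
  by_cases hne : ∃ x : ℝ, x ∈ Set.Ioo (0 : ℝ) 1 ∧ Real.exp (-lam * x) = 1 - x
  · obtain ⟨x, hx, hxe⟩ := hne
    rw [theta_eq hlam hx.1 hx.2 hxe]
    exact ⟨hx.1, hx.2, hxe⟩
  · refine (h ?_).elim
    rw [theta, if_neg (not_le.2 hlam), show {x : ℝ | x ∈ Set.Ioo (0 : ℝ) 1 ∧
      Real.exp (-lam * x) = 1 - x} = ∅ from Set.eq_empty_iff_forall_notMem.2 ?_, Real.sSup_empty]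
    exact fun x hx => hne ⟨x, hx⟩

/-- The fixed point `aFix` expressed through the solution of the gap equation. -/
theorem aFix_eq {q : ℕ} (hq : 2 ≤ q) {β d t : ℝ} (hβ : (q : ℝ) < β) (hd : 0 < d)
    (h : gapFun q β d = 0) (ht : q * t + d = β) (ht0 : 0 < t) :
    aFix q β = (t + d) / β := by
  have hq2 : (2 : ℝ) ≤ q := by exact_mod_cast hq
  have hq0 : (0 : ℝ) < q := by linarith
  have hβ0 : 0 < β := hq0.trans hβ
  have hexp : (t + d) * Real.exp (-d) = t := by
    have h1 : q * ((t + d) * Real.exp (-d)) = q * t := by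
      unfold gapFun at h
      linear_combination Real.exp (-d) * ht - h - ht
    exact mul_left_cancel₀ hq0.ne' h1
  have hs : 1 < t + d := by nlinarith
  have hset : {x : ℝ | x ∈ Set.Ioc (1 / (q : ℝ)) 1 ∧ F q β x = x} = {(t + d) / β} := by
    ext x
    simp only [Set.mem_ofPred_eq, Set.mem_singleton_iff, Set.mem_Ioc]
    constructor
    · rintro ⟨⟨hx1, hx2⟩, hF⟩
      have hx0 : 0 < x := lt_trans (by positivity) hx1
      have hne : theta (β * x) ≠ 0 := by
        intro h0
        rw [F, h0] at hF
        linarith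
      obtain ⟨hp, hl, he⟩ := theta_spec hne
      set τ := theta (β * x) with hτ
      have hFq : x * (q - (q - 1) * τ) = 1 := by
        rw [F, ← hτ] at hF
        field_simp at hF
        linarith
      have hde : β * x * τ = d := by
        refine gapFun_root_unique hβ (by positivity) hd ?_ h
        have he' : Real.exp (-(β * x * τ)) = 1 - τ := by rw [← he]; ring_nf
        rw [gapFun, he']
        linear_combination (-β * τ) * hFq
      have he' : Real.exp (-d) = 1 - τ := by rw [← he, ← hde]; ring_nf
      rw [he'] at hexp
      have h3 : (t + d) * (q - (q - 1) * τ) = β := by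
        linear_combination ht + (q - 1) * hexp
      have h4 : 0 < q - (q - 1) * τ := by nlinarith
      have h5 : (t + d) = x * β := by
        rw [← h3, ← mul_assoc, mul_comm x, mul_assoc, hFq, mul_one]
      rw [h5]; field_simp
    · rintro rfl
      have hτ : theta (β * ((t + d) / β)) = d / (t + d) := by
        rw [show β * ((t + d) / β) = t + d by field_simp]
        refine theta_eq hs (by positivity) ((div_lt_one (by linarith)).2 (by linarith)) ?_
        rw [show -(t + d) * (d / (t + d)) = -d by field_simp]
        have : t + d ≠ 0 := by linarith
        field_simp
        linarith
      refine ⟨⟨?_, ?_⟩, ?_⟩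
      · rw [div_lt_div_iff₀ hq0 hβ0]; nlinarith
      · rw [div_le_one hβ0]; nlinarith
      · rw [F, hτ]
        have : t + d ≠ 0 := by linarith
        rw [← ht]
        have : q * t + d ≠ 0 := by linarith
        field_simp
        ring
  rw [aFix, hset, csSup_singleton]

/-- The mean-field Potts functional in the dual (Hubbard–Stratonovich) variables. -/
noncomputable def pottsPhi (q : ℕ) (β : ℝ) (y : EuclideanSpace ℝ (Fin q)) : ℝ :=
  Real.log (∑ j, Real.exp (y j)) - ‖y‖ ^ 2 / (2 * β)

/-- The ordered point with coordinate `t + d` at `k` and `t` elsewhere. -/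
noncomputable def orderedPt (q : ℕ) (t d : ℝ) (k : Fin q) : EuclideanSpace ℝ (Fin q) :=
  WithLp.toLp 2 (fun j => if j = k then t + d else t)

theorem orderedPt_apply {q : ℕ} (t d : ℝ) (k j : Fin q) :
    orderedPt q t d k j = if j = k then t + d else t := rfl

theorem sum_orderedPt {q : ℕ} (t d : ℝ) (k : Fin q) (f : ℝ → ℝ) :
    ∑ j, f (orderedPt q t d k j) = q * f t + (f (t + d) - f t) := by
  have : ∀ j, f (orderedPt q t d k j) = f t + if j = k then f (t + d) - f t else 0 := by
    intro j
    rw [orderedPt_apply]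
    split_ifs <;> ring
  simp [this, Finset.sum_add_distrib]

theorem sum_exp_pos {q : ℕ} (hq : 2 ≤ q) (y : EuclideanSpace ℝ (Fin q)) :
    0 < ∑ j, Real.exp (y j) := by
  have : Nonempty (Fin q) := ⟨⟨0, by omega⟩⟩
  exact Finset.sum_pos (fun _ _ => Real.exp_pos _) Finset.univ_nonempty

theorem continuous_pottsPhi {q : ℕ} (hq : 2 ≤ q) (β : ℝ) : Continuous (pottsPhi q β) := by
  unfold pottsPhi
  refine Continuous.sub (Continuous.log (by fun_prop) fun y => (sum_exp_pos hq y).ne') (by fun_prop)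

theorem pottsPhi_zero (q : ℕ) (β : ℝ) : pottsPhi q β 0 = Real.log q := by
  simp [pottsPhi]

theorem pottsPhi_le {q : ℕ} (hq : 2 ≤ q) (β : ℝ) (y : EuclideanSpace ℝ (Fin q)) :
    pottsPhi q β y ≤ Real.log q + ‖y‖ - ‖y‖ ^ 2 / (2 * β) := by
  have hq0 : (0 : ℝ) < q := by positivity
  have h : ∑ j, Real.exp (y j) ≤ q * Real.exp ‖y‖ := by
    calc ∑ j, Real.exp (y j) ≤ ∑ _j : Fin q, Real.exp ‖y‖ := by
          gcongr with j
          exact (le_abs_self _).trans (PiLp.norm_apply_le y j)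
      _ = _ := by simp
  have := Real.log_le_log (sum_exp_pos hq y) h
  rw [Real.log_mul hq0.ne' (Real.exp_pos _).ne', Real.log_exp] at this
  unfold pottsPhi
  linarith

theorem pottsPhi_lt_of_norm {q : ℕ} (hq : 2 ≤ q) {β : ℝ} (hβ : 0 < β)
    {y : EuclideanSpace ℝ (Fin q)} (hy : 2 * β < ‖y‖) : pottsPhi q β y < pottsPhi q β 0 := by
  have h := pottsPhi_le hq β y
  have : ‖y‖ < ‖y‖ ^ 2 / (2 * β) := by
    rw [lt_div_iff₀ (by positivity)]
    nlinarith
  rw [pottsPhi_zero]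
  linarith

theorem exists_pottsPhi_max {q : ℕ} (hq : 2 ≤ q) {β : ℝ} (hβ : 0 < β) :
    ∃ z, ∀ y, pottsPhi q β y ≤ pottsPhi q β z := by
  obtain ⟨z, -, hz⟩ := (isCompact_closedBall (0 : EuclideanSpace ℝ (Fin q)) (2 * β)).exists_isMaxOn
    ⟨0, Metric.mem_closedBall_self (by positivity)⟩ (continuous_pottsPhi hq β).continuousOn
  refine ⟨z, fun y => ?_⟩
  by_cases hy : ‖y‖ ≤ 2 * β
  · exact hz (by simpa using hy)
  · exact (pottsPhi_lt_of_norm hq hβ (not_le.1 hy)).le.trans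
      (hz (Metric.mem_closedBall_self (by positivity)))

theorem pottsPhi_add {q : ℕ} (β : ℝ) (y : EuclideanSpace ℝ (Fin q)) (h : Fin q → ℝ) :
    pottsPhi q β (y + WithLp.toLp 2 h) = Real.log (∑ j, Real.exp (y j) * Real.exp (h j)) -
      (‖y‖ ^ 2 + 2 * ∑ j, y j * h j + ∑ j, h j ^ 2) / (2 * β) := by
  have h1 : ‖y + WithLp.toLp 2 h‖ ^ 2 = ‖y‖ ^ 2 + 2 * ∑ j, y j * h j + ∑ j, h j ^ 2 := by
    simp only [EuclideanSpace.real_norm_sq_eq, PiLp.add_apply, Finset.mul_sum,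
      ← Finset.sum_add_distrib]
    refine Finset.sum_congr rfl fun j _ => ?_
    ring
  rw [pottsPhi, h1]
  simp [Real.exp_add]

theorem max_critical {q : ℕ} (hq : 2 ≤ q) {β : ℝ} (hβ : 0 < β) {z : EuclideanSpace ℝ (Fin q)}
    (hz : ∀ y, pottsPhi q β y ≤ pottsPhi q β z) (k : Fin q) :
    z k * ∑ j, Real.exp (z j) = β * Real.exp (z k) := by
  set S := ∑ j, Real.exp (z j) with hS
  have hS0 : 0 < S := sum_exp_pos hq z
  have hline : ∀ ξ : ℝ, pottsPhi q β (z + WithLp.toLp 2 (Pi.single k ξ)) =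
      Real.log (S + Real.exp (z k) * (Real.exp ξ - 1)) -
        (‖z‖ ^ 2 + 2 * (z k * ξ) + ξ ^ 2) / (2 * β) := by
    intro ξ
    rw [pottsPhi_add]
    congr 2
    · have : ∀ j, Real.exp (z j) * Real.exp ((Pi.single k ξ : Fin q → ℝ) j) = Real.exp (z j) +
          if j = k then Real.exp (z k) * (Real.exp ξ - 1) else 0 := by
        intro j
        by_cases hj : j = k
        · subst hj; simp; ring
        · simp [hj]
      simp [this, Finset.sum_add_distrib, hS]
    · simp [Pi.single_apply, ite_pow]
  have hmax : IsLocalMax (fun ξ : ℝ => Real.log (S + Real.exp (z k) * (Real.exp ξ - 1)) -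
        (‖z‖ ^ 2 + 2 * (z k * ξ) + ξ ^ 2) / (2 * β)) 0 := by
    refine Filter.Eventually.of_forall fun ξ => ?_
    have := hz (z + WithLp.toLp 2 (Pi.single k ξ))
    rw [hline] at this
    refine this.trans (le_of_eq ?_)
    simp [pottsPhi, hS]
  have hd : HasDerivAt (fun ξ : ℝ => Real.log (S + Real.exp (z k) * (Real.exp ξ - 1)) -
        (‖z‖ ^ 2 + 2 * (z k * ξ) + ξ ^ 2) / (2 * β))
        (Real.exp (z k) / S - z k / β) 0 := by
    have h1 : HasDerivAt (fun ξ : ℝ => S + Real.exp (z k) * (Real.exp ξ - 1))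
        (Real.exp (z k)) 0 := by
      have := (((Real.hasDerivAt_exp 0).sub_const 1).const_mul (Real.exp (z k))).const_add S
      simpa using this
    have h2 := h1.log (by simpa using hS0.ne')
    have h3 : HasDerivAt (fun ξ : ℝ => (‖z‖ ^ 2 + 2 * (z k * ξ) + ξ ^ 2) / (2 * β))
        ((2 * z k) / (2 * β)) 0 := by
      have := ((((hasDerivAt_id' (0 : ℝ)).const_mul (z k)).const_mul 2).const_add (‖z‖ ^ 2)).add
        ((hasDerivAt_id' (0 : ℝ)).pow 2)
      simpa using this.div_const (2 * β)
    refine (h2.sub h3).congr_deriv ?_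
    simp [mul_div_mul_left]
  have := hmax.hasDerivAt_eq_zero hd
  have h4 : z k / β = Real.exp (z k) / S := by linarith
  field_simp at h4
  exact h4

theorem sq_le_exp_add_exp_neg (x : ℝ) : x ^ 2 ≤ Real.exp x + Real.exp (-x) - 2 := by
  have h1 : Real.exp x + Real.exp (-x) - 2 = 4 * Real.sinh (x / 2) ^ 2 := by
    have h2 := Real.cosh_two_mul (x / 2)
    have h3 := Real.cosh_sq (x / 2)
    rw [mul_div_cancel₀ x two_ne_zero, Real.cosh_eq] at h2
    linarith
  have h4 : |x / 2| ≤ |Real.sinh (x / 2)| := by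
    rw [Real.abs_sinh]
    exact Real.self_le_sinh_iff.2 (abs_nonneg _)
  have h5 := sq_le_sq.2 h4
  rw [h1]
  linarith

theorem max_pair_le_one {q : ℕ} (hq : 2 ≤ q) {β : ℝ} (hβ : 0 < β) {z : EuclideanSpace ℝ (Fin q)}
    (hz : ∀ y, pottsPhi q β y ≤ pottsPhi q β z) {i k : Fin q} (hik : i ≠ k) (heq : z i = z k) :
    z k ≤ 1 := by
  by_contra! hm
  set S := ∑ j, Real.exp (z j) with hS
  have hS0 : 0 < S := sum_exp_pos hq z
  have hcrit := max_critical hq hβ hz k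
  rw [← hS] at hcrit
  set m := z k with hmdef
  have hmS : Real.exp m = m / β * S := by
    field_simp
    linarith
  have hm0 : 0 < m := by linarith
  obtain ⟨δ, hδ0, hδ⟩ : ∃ δ : ℝ, 0 < δ ∧ m * δ ^ 2 < β * (m - 1) := by
    refine ⟨Real.sqrt (β * (m - 1) / (2 * m)), Real.sqrt_pos.2 ?_, ?_⟩
    · exact div_pos (mul_pos hβ (by linarith)) (by linarith)
    · rw [Real.sq_sqrt (div_nonneg (mul_nonneg hβ.le (by linarith)) (by linarith))]
      have : 0 < β * (m - 1) := mul_pos hβ (by linarith)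
      field_simp
      linarith
  have h := hz (z + WithLp.toLp 2 (Pi.single i δ - Pi.single k δ))
  rw [pottsPhi_add] at h
  have e1 : ∑ j, z j * ((Pi.single i δ - Pi.single k δ : Fin q → ℝ)) j = 0 := by
    simp [Pi.single_apply, mul_sub, Finset.sum_sub_distrib, heq, hmdef]
  have e2 : ∑ j, ((Pi.single i δ - Pi.single k δ : Fin q → ℝ)) j ^ 2 = 2 * δ ^ 2 := by
    have : ∀ j, ((Pi.single i δ - Pi.single k δ : Fin q → ℝ)) j ^ 2 =
        (if j = i then δ ^ 2 else 0) + (if j = k then δ ^ 2 else 0) := by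
      intro j
      by_cases h1 : j = i
      · subst h1; simp [hik]
      · by_cases h2 : j = k
        · subst h2; simp [h1]
        · simp [h1, h2]
    simp only [this, Finset.sum_add_distrib, Finset.sum_ite_eq', Finset.mem_univ, if_true]
    ring
  have e3 : ∑ j, Real.exp (z j) * Real.exp (((Pi.single i δ - Pi.single k δ : Fin q → ℝ)) j) =
      S + Real.exp m * (Real.exp δ - 1) + Real.exp m * (Real.exp (-δ) - 1) := by
    have : ∀ j, Real.exp (z j) * Real.exp (((Pi.single i δ - Pi.single k δ : Fin q → ℝ)) j) =
        Real.exp (z j) + (if j = i then Real.exp m * (Real.exp δ - 1) else 0) +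
          (if j = k then Real.exp m * (Real.exp (-δ) - 1) else 0) := by
      intro j
      by_cases h1 : j = i
      · subst h1; simp [hik, heq]; ring
      · by_cases h2 : j = k
        · subst h2; simp [h1, ← hmdef]; ring
        · simp [h1, h2]
    simp only [this, Finset.sum_add_distrib, Finset.sum_ite_eq', Finset.mem_univ, if_true, hS]
  rw [e1, e2, e3, pottsPhi, ← hS] at h
  have hcosh : δ ^ 2 ≤ Real.exp δ + Real.exp (-δ) - 2 := sq_le_exp_add_exp_neg δ
  have hlog : Real.log (S * (1 + m / β * δ ^ 2)) ≤
      Real.log (S + Real.exp m * (Real.exp δ - 1) + Real.exp m * (Real.exp (-δ) - 1)) := by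
    apply Real.log_le_log (by positivity)
    have := mul_le_mul_of_nonneg_left hcosh (Real.exp_pos m).le
    calc S * (1 + m / β * δ ^ 2) = S + Real.exp m * δ ^ 2 := by rw [hmS]; ring
      _ ≤ _ := by linarith
  rw [Real.log_mul hS0.ne' (by positivity)] at hlog
  have hx : 0 < m / β * δ ^ 2 := by positivity
  have hlow := Real.one_sub_inv_le_log_of_pos (show 0 < 1 + m / β * δ ^ 2 by positivity)
  have hfin : 1 - (1 + m / β * δ ^ 2)⁻¹ ≤ δ ^ 2 / β := by
    have : (‖z‖ ^ 2 + 2 * 0 + 2 * δ ^ 2) / (2 * β) = ‖z‖ ^ 2 / (2 * β) + δ ^ 2 / β := by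
      field_simp; ring
    linarith
  have hne : (1 + m / β * δ ^ 2) ≠ 0 := by positivity
  have hfin2 : m / β * δ ^ 2 ≤ δ ^ 2 / β * (1 + m / β * δ ^ 2) := by
    have := mul_le_mul_of_nonneg_right hfin (show 0 ≤ 1 + m / β * δ ^ 2 by positivity)
    rw [sub_mul, inv_mul_cancel₀ hne] at this
    linarith
  have : δ ^ 2 / β * (1 + m / β * δ ^ 2) = δ ^ 2 / β ^ 2 * (β + m * δ ^ 2) := by
    field_simp
  rw [this, show m / β * δ ^ 2 = δ ^ 2 / β ^ 2 * (m * β) by field_simp] at hfin2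
  have := le_of_mul_le_mul_left hfin2 (by positivity)
  nlinarith

theorem lt_one_of_mul_eq_exp {y z S β : ℝ} (hS : 0 < S) (hβ : 0 < β) (hyz : y < z)
    (hy : y * S = β * Real.exp y) (hz : z * S = β * Real.exp z) : y < 1 ∧ 1 < z := by
  have hy0 : 0 < y := pos_of_mul_pos_left (hy ▸ mul_pos hβ (Real.exp_pos y)) hS.le
  have hz0 : 0 < z := hy0.trans hyz
  have h1 : z = y * Real.exp (z - y) := by
    apply mul_right_cancel₀ hS.ne'
    rw [hz, mul_right_comm, hy, mul_assoc, ← Real.exp_add]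
    ring_nf
  have h2 : y = z * Real.exp (y - z) := by
    apply mul_right_cancel₀ hS.ne'
    rw [hy, mul_right_comm, hz, mul_assoc, ← Real.exp_add]
    ring_nf
  have h3 := Real.add_one_lt_exp (sub_ne_zero.2 hyz.ne')
  have h4 := Real.add_one_lt_exp (sub_ne_zero.2 hyz.ne)
  constructor
  · by_contra! hc
    nlinarith [mul_lt_mul_of_pos_left h3 hy0]
  · by_contra! hc
    nlinarith [mul_lt_mul_of_pos_left h4 hz0]

/-- Every global maximizer of the functional is an ordered point. -/
theorem max_eq_orderedPt {q : ℕ} (hq : 2 ≤ q) {β : ℝ} (hβ : (q : ℝ) < β)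
    {z : EuclideanSpace ℝ (Fin q)} (hz : ∀ y, pottsPhi q β y ≤ pottsPhi q β z) :
    ∃ (t d : ℝ) (k : Fin q), 0 < t ∧ t < 1 ∧ 0 < d ∧ q * t + d = β ∧ gapFun q β d = 0 ∧
      z = orderedPt q t d k := by
  have hq2 : (2 : ℝ) ≤ q := by exact_mod_cast hq
  have hβ0 : 0 < β := by linarith
  set S := ∑ j, Real.exp (z j) with hS
  have hS0 : 0 < S := sum_exp_pos hq z
  have hcrit : ∀ k, z k * S = β * Real.exp (z k) := max_critical hq hβ0 hz
  have hpos : ∀ k, 0 < z k := fun k =>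
    pos_of_mul_pos_left (hcrit k ▸ mul_pos hβ0 (Real.exp_pos (z k))) hS0.le
  have hsum : ∑ j, z j = β := by
    apply mul_right_cancel₀ hS0.ne'
    rw [Finset.sum_mul, Finset.sum_congr rfl fun j _ => hcrit j, ← Finset.mul_sum, ← hS]
  obtain ⟨k, hk⟩ : ∃ k, 1 < z k := by
    by_contra! hle
    have : ∑ j, z j ≤ ∑ _j : Fin q, (1 : ℝ) := Finset.sum_le_sum fun j _ => hle j
    simp at this
    linarith
  have hother : ∀ j, j ≠ k → z j < 1 := by
    intro j hj
    rcases lt_trichotomy (z j) (z k) with h | h | h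
    · exact (lt_one_of_mul_eq_exp hS0 hβ0 h (hcrit j) (hcrit k)).1
    · exact absurd (max_pair_le_one hq hβ0 hz hj h) (not_le.2 hk)
    · exact absurd (lt_one_of_mul_eq_exp hS0 hβ0 h (hcrit k) (hcrit j)).1 (not_lt.2 hk.le)
  obtain ⟨i, hik⟩ : ∃ i : Fin q, i ≠ k := by
    have : Nontrivial (Fin q) := Fin.nontrivial_iff_two_le.2 hq
    exact exists_ne k
  have hall : ∀ j, j ≠ k → z j = z i := by
    intro j hj
    rcases lt_trichotomy (z j) (z i) with h | h | h
    · exact absurd (lt_one_of_mul_eq_exp hS0 hβ0 h (hcrit j) (hcrit i)).2 (not_lt.2 (hother i hik).le)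
    · exact h
    · exact absurd (lt_one_of_mul_eq_exp hS0 hβ0 h (hcrit i) (hcrit j)).2 (not_lt.2 (hother j hj).le)
  have hzeq : z = orderedPt q (z i) (z k - z i) k := by
    ext j
    rw [orderedPt_apply]
    split_ifs with hj
    · rw [hj]; ring
    · exact hall j hj
  have hqt : q * z i + (z k - z i) = β := by
    rw [← hsum]
    conv_rhs => rw [hzeq]
    rw [sum_orderedPt _ _ _ (fun x => x)]
    ring
  refine ⟨z i, z k - z i, k, hpos i, hother i hik, by linarith [hother i hik], hqt, ?_, hzeq⟩
  have hexp : z k * Real.exp (-(z k - z i)) = z i := by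
    apply mul_right_cancel₀ hS0.ne'
    rw [mul_right_comm, hcrit k, hcrit i, mul_assoc, ← Real.exp_add]
    ring_nf
  rw [gapFun]
  set e := Real.exp (-(z k - z i))
  rw [← hqt]
  linear_combination -q * hexp

theorem pottsPhi_orderedPt {q : ℕ} (β t d : ℝ) (k l : Fin q) :
    pottsPhi q β (orderedPt q t d k) = pottsPhi q β (orderedPt q t d l) := by
  simp only [pottsPhi, EuclideanSpace.real_norm_sq_eq]
  rw [sum_orderedPt _ _ _ Real.exp, sum_orderedPt _ _ _ Real.exp,
    sum_orderedPt _ _ _ (fun x => x ^ 2), sum_orderedPt _ _ _ (fun x => x ^ 2)]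

theorem pottsPhi_max_add {q : ℕ} (hq : 2 ≤ q) {β : ℝ} (hβ : 0 < β) {z : EuclideanSpace ℝ (Fin q)}
    (hz : ∀ y, pottsPhi q β y ≤ pottsPhi q β z) (h : Fin q → ℝ) :
    pottsPhi q β (z + WithLp.toLp 2 h) = pottsPhi q β z +
      Real.log (∑ j, z j / β * Real.exp (h j - ∑ i, z i / β * h i)) -
        (∑ j, h j ^ 2) / (2 * β) := by
  have hS0 := sum_exp_pos hq z
  have hcrit := max_critical hq hβ hz
  have hz0 : ∀ j, 0 < z j := fun j =>
    pos_of_mul_pos_left (hcrit j ▸ mul_pos hβ (Real.exp_pos (z j))) hS0.le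
  rw [pottsPhi_add, pottsPhi]
  set S := ∑ j, Real.exp (z j) with hS
  set m := ∑ i, z i / β * h i with hm
  have h1 : ∑ j, Real.exp (z j) * Real.exp (h j) =
      S * (Real.exp m * ∑ j, z j / β * Real.exp (h j - m)) := by
    rw [Finset.mul_sum, Finset.mul_sum]
    refine Finset.sum_congr rfl fun j _ => ?_
    rw [Real.exp_sub]
    have := hcrit j
    have := Real.exp_pos m
    field_simp
    linarith
  have : Nonempty (Fin q) := ⟨⟨0, by omega⟩⟩
  have hV : 0 < ∑ j, z j / β * Real.exp (h j - m) :=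
    Finset.sum_pos (fun j _ => mul_pos (div_pos (hz0 j) hβ) (Real.exp_pos _))
      Finset.univ_nonempty
  have h2 : ∑ j, z j * h j = β * m := by
    rw [hm, Finset.mul_sum]
    refine Finset.sum_congr rfl fun j _ => ?_
    field_simp
  rw [h1, Real.log_mul hS0.ne' (by positivity), Real.log_mul (Real.exp_pos _).ne' hV.ne',
    Real.log_exp, h2]
  field_simp
  ring

theorem sum_max {q : ℕ} (hq : 2 ≤ q) {β : ℝ} (hβ : 0 < β) {z : EuclideanSpace ℝ (Fin q)}
    (hz : ∀ y, pottsPhi q β y ≤ pottsPhi q β z) : ∑ j, z j / β = 1 := by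
  have hS0 := sum_exp_pos hq z
  rw [← Finset.sum_div, div_eq_one_iff_eq hβ.ne']
  apply mul_right_cancel₀ hS0.ne'
  rw [Finset.sum_mul, Finset.sum_congr rfl fun j _ => max_critical hq hβ hz j, ← Finset.mul_sum]

/-- Convexity of log-sum-exp gives a quadratic lower bound at a maximizer. -/
theorem pottsPhi_ge_of_max {q : ℕ} (hq : 2 ≤ q) {β : ℝ} (hβ : 0 < β)
    {z : EuclideanSpace ℝ (Fin q)} (hz : ∀ y, pottsPhi q β y ≤ pottsPhi q β z)
    (y : EuclideanSpace ℝ (Fin q)) :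
    pottsPhi q β z - ‖y - z‖ ^ 2 / (2 * β) ≤ pottsPhi q β y := by
  have hS0 := sum_exp_pos hq z
  have hcrit := max_critical hq hβ hz
  have hz0 : ∀ j, 0 < z j := fun j =>
    pos_of_mul_pos_left (hcrit j ▸ mul_pos hβ (Real.exp_pos (z j))) hS0.le
  have h := pottsPhi_max_add hq hβ hz (fun j => (y - z) j)
  rw [← EuclideanSpace.real_norm_sq_eq] at h
  have hy : z + WithLp.toLp 2 (fun j => (y - z) j) = y := by
    ext j; simp
  rw [hy] at h
  rw [h]
  set m := ∑ i, z i / β * (y - z) i with hm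
  have h1 : 1 ≤ ∑ j, z j / β * Real.exp ((y - z) j - m) := by
    calc (1 : ℝ) = ∑ j, z j / β * ((y - z) j - m + 1) := by
          simp only [mul_add, mul_sub, Finset.sum_add_distrib, Finset.sum_sub_distrib,
            ← Finset.sum_mul, sum_max hq hβ hz, ← hm]
          ring
      _ ≤ _ := by
          gcongr with j
          · exact (div_pos (hz0 j) hβ).le
          · exact Real.add_one_le_exp _
  have := Real.log_nonneg h1
  linarith

theorem exp_le_of_abs_le {g η : ℝ} (hη : η ≤ 1) (hg : |g| ≤ η) :
    Real.exp g ≤ 1 + g + (1 + η) / 2 * g ^ 2 := by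
  have h := Real.exp_bound (hg.trans hη) (show 0 < 3 by norm_num)
  simp [Finset.sum_range_succ, Nat.factorial] at h
  have h1 := (abs_le.1 h).2
  have h2 : |g| ^ 3 ≤ η * g ^ 2 := by
    rw [← sq_abs g]
    nlinarith [mul_le_mul_of_nonneg_right hg (sq_nonneg |g|)]
  have h3 : 0 ≤ η * g ^ 2 := mul_nonneg ((abs_nonneg g).trans hg) (sq_nonneg g)
  linarith

/-- The Hessian condition at an ordered maximizer. -/
theorem gap_nondegenerate {q β d t : ℝ} (hβ : q < β) (hq : 0 < q) (hd : 0 < d)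
    (h : gapFun q β d = 0) (ht : q * t + d = β) : q * t * (t + d) < β := by
  have hneg := gapDeriv_neg hβ hd h
  have he := Real.add_one_lt_exp hd.ne'
  have hee : Real.exp (-d) * Real.exp d = 1 := by rw [← Real.exp_add]; simp
  rw [gapFun] at h
  set E := Real.exp d
  set e := Real.exp (-d)
  have h1 : t * (E - 1) = d := by
    have : q * (t * (E - 1)) = q * d := by
      linear_combination (E - 1) * ht + E * h + (β + (q - 1) * d) * hee
    exact mul_left_cancel₀ hq.ne' this
  have ht0 : 0 < t := by
    by_contra! hc
    nlinarith
  have h2 : t * (β - (q - 1) + (q - 1) * d - E) < 0 := mul_neg_of_pos_of_neg ht0 hneg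
  have h3 : t * E = t + d := by linarith
  have h4 : t * (β - (q - 1) + (q - 1) * d) < t + d := by linarith
  nlinarith

theorem variance_orderedPt_le {q : ℕ} (hq : 2 ≤ q) {β t d : ℝ} (hβ : 0 < β) (ht0 : 0 < t)
    (hd : 0 < d) (hqt : q * t + d = β) (k : Fin q) {ρ : ℝ} (hρ1 : t ≤ ρ)
    (hρ2 : q * t * (t + d) ≤ ρ * β) (h : Fin q → ℝ) :
    ∑ j, orderedPt q t d k j / β * (h j - ∑ i, orderedPt q t d k i / β * h i) ^ 2 ≤
      ρ / β * ∑ j, h j ^ 2 := by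
  have hq2 : (2 : ℝ) ≤ q := by exact_mod_cast hq
  have hfun : ∀ f : Fin q → ℝ, ∑ j, orderedPt q t d k j / β * f j =
      (t * ∑ j, f j + d * f k) / β := by
    intro f
    have : ∀ j, orderedPt q t d k j / β * f j =
        t / β * f j + if j = k then d / β * f k else 0 := by
      intro j
      rw [orderedPt_apply]
      split_ifs with hj
      · subst hj; ring
      · ring
    simp only [this, Finset.sum_add_distrib, ← Finset.mul_sum, Finset.sum_ite_eq',
      Finset.mem_univ, if_true]
    ring
  rw [hfun, hfun]
  set T := ∑ j, h j with hT
  set B := ∑ j, h j ^ 2 with hB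
  set u := h k with hu
  set m := (t * T + d * u) / β with hm
  have hmβ : m * β = t * T + d * u := by rw [hm]; field_simp
  have h1 : ∑ j, (h j - m) ^ 2 = B - 2 * m * T + q * m ^ 2 := by
    simp only [sub_sq, Finset.sum_add_distrib, Finset.sum_sub_distrib, hB, hT, Finset.mul_sum,
      Finset.sum_const, Finset.card_univ, Fintype.card_fin, nsmul_eq_mul]
    congr 2
    refine Finset.sum_congr rfl fun j _ => by ring
  have hcs : (T - u) ^ 2 ≤ (q - 1) * (B - u ^ 2) := by
    have h2 := sq_sum_le_card_mul_sum_sq (s := Finset.univ.erase k) (f := h)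
    rw [Finset.card_erase_of_mem (Finset.mem_univ k), Finset.card_univ, Fintype.card_fin,
      Nat.cast_sub (by omega), Finset.sum_erase_eq_sub (Finset.mem_univ k),
      Finset.sum_erase_eq_sub (Finset.mem_univ k)] at h2
    simpa using h2
  rw [h1]
  have hw0 : (0 : ℝ) < q - 1 := by linarith
  obtain ⟨w, hw⟩ : ∃ w, T = u + (q - 1) * w := ⟨(T - u) / (q - 1), by field_simp; ring⟩
  have hR : 0 ≤ B - u ^ 2 - (q - 1) * w ^ 2 := by
    rw [hw] at hcs
    have : (q - 1) * ((q - 1) * w ^ 2) ≤ (q - 1) * (B - u ^ 2) := by linarith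
    have := le_of_mul_le_mul_left this hw0
    linarith
  have hvar : t * (B - 2 * m * T + q * m ^ 2) + d * (u - m) ^ 2 =
      t * (B - u ^ 2 - (q - 1) * w ^ 2) + t * (t + d) * (q - 1) / β * (u - w) ^ 2 := by
    have hm2 : m = w + (t + d) / β * (u - w) := by
      rw [hm, hw]
      field_simp
      rw [← hqt]
      ring
    rw [hm2, hw]
    field_simp
    rw [← hqt]
    ring
  have hcs2 : (q - 1) * (u - w) ^ 2 ≤ q * (u ^ 2 + (q - 1) * w ^ 2) := by
    nlinarith [sq_nonneg (u + (q - 1) * w)]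
  rw [div_mul_eq_mul_div, div_le_div_iff_of_pos_right hβ, hvar]
  have h3 : t * (t + d) * (q - 1) / β * (u - w) ^ 2 ≤ ρ * (u ^ 2 + (q - 1) * w ^ 2) := by
    calc t * (t + d) * (q - 1) / β * (u - w) ^ 2 = t * (t + d) / β * ((q - 1) * (u - w) ^ 2) := by
          ring
      _ ≤ t * (t + d) / β * (q * (u ^ 2 + (q - 1) * w ^ 2)) := by gcongr
      _ = (q * t * (t + d)) / β * (u ^ 2 + (q - 1) * w ^ 2) := by ring
      _ ≤ (ρ * β) / β * (u ^ 2 + (q - 1) * w ^ 2) := by gcongr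
      _ = _ := by field_simp
  nlinarith [mul_le_mul_of_nonneg_right hρ1 hR]

/-- Quadratic decay of the functional near an ordered maximizer. -/
theorem pottsPhi_local {q : ℕ} (hq : 2 ≤ q) {β t d : ℝ} (hβ : (q : ℝ) < β) (ht0 : 0 < t)
    (ht1 : t < 1) (hd : 0 < d) (hqt : q * t + d = β) (hgap : gapFun q β d = 0)
    (hz : ∀ k y, pottsPhi q β y ≤ pottsPhi q β (orderedPt q t d k)) :
    ∃ c ε : ℝ, 0 < c ∧ 0 < ε ∧ ∀ k y, ‖y - orderedPt q t d k‖ ≤ ε →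
      pottsPhi q β y ≤ pottsPhi q β (orderedPt q t d k) - c * ‖y - orderedPt q t d k‖ ^ 2 := by
  have hq2 : (2 : ℝ) ≤ q := by exact_mod_cast hq
  have hβ0 : 0 < β := by linarith
  have hnd := gap_nondegenerate hβ (by linarith) hd hgap hqt
  obtain ⟨ρ, hρ0, hρ1, htρ, hρ2⟩ :
      ∃ ρ : ℝ, 0 < ρ ∧ ρ < 1 ∧ t ≤ ρ ∧ q * t * (t + d) ≤ ρ * β := by
    refine ⟨max t (q * t * (t + d) / β), lt_max_of_lt_left ht0,
      max_lt ht1 ((div_lt_one hβ0).2 hnd), le_max_left _ _, ?_⟩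
    rw [← div_le_iff₀ hβ0]
    exact le_max_right _ _
  refine ⟨(1 - ρ) ^ 2 / (2 * β), (1 - ρ) / 2, ?_, by linarith, ?_⟩
  · have : 0 < 1 - ρ := by linarith
    positivity
  intro k y hy
  set z := orderedPt q t d k with hzdef
  have hmax := hz k
  have hz0 : ∀ j, 0 ≤ z j / β := fun j => by
    rw [hzdef, orderedPt_apply]
    split_ifs <;> positivity
  have h := pottsPhi_max_add hq hβ0 hmax (fun j => (y - z) j)
  have hy' : z + WithLp.toLp 2 (fun j => (y - z) j) = y := by
    ext j; simp
  have hvar := variance_orderedPt_le hq hβ0 ht0 hd hqt k htρ hρ2 (fun j => (y - z) j)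
  rw [← hzdef] at hvar
  rw [hy'] at h
  rw [h]
  simp only [← EuclideanSpace.real_norm_sq_eq] at hvar ⊢
  set m := ∑ i, z i / β * (y - z) i with hm
  have hsum := sum_max hq hβ0 hmax
  rw [← hzdef] at hsum
  have hcoord : ∀ j, |(y - z) j| ≤ (1 - ρ) / 2 := fun j => (PiLp.norm_apply_le (y - z) j).trans hy
  have hmabs : |m| ≤ (1 - ρ) / 2 := by
    calc |m| ≤ ∑ i, |z i / β * (y - z) i| := Finset.abs_sum_le_sum_abs _ _
      _ ≤ ∑ i, z i / β * ((1 - ρ) / 2) := by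
          refine Finset.sum_le_sum fun i _ => ?_
          rw [abs_mul, abs_of_nonneg (hz0 i)]
          exact mul_le_mul_of_nonneg_left (hcoord i) (hz0 i)
      _ = _ := by rw [← Finset.sum_mul, hsum, one_mul]
  have hV : ∑ j, z j / β * Real.exp ((y - z) j - m) ≤
      1 + (1 + (1 - ρ)) / 2 * ∑ j, z j / β * ((y - z) j - m) ^ 2 := by
    calc ∑ j, z j / β * Real.exp ((y - z) j - m)
        ≤ ∑ j, z j / β * (1 + ((y - z) j - m) + (1 + (1 - ρ)) / 2 * ((y - z) j - m) ^ 2) := by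
          refine Finset.sum_le_sum fun j _ => mul_le_mul_of_nonneg_left ?_ (hz0 j)
          refine exp_le_of_abs_le (by linarith) ((abs_sub _ _).trans ?_)
          linarith [hcoord j]
      _ = _ := by
          have : ∀ j, z j / β * (1 + ((y - z) j - m) + (1 + (1 - ρ)) / 2 * ((y - z) j - m) ^ 2) =
              z j / β + (z j / β * (y - z) j - z j / β * m) +
                (1 + (1 - ρ)) / 2 * (z j / β * ((y - z) j - m) ^ 2) := fun j => by ring
          simp only [this, Finset.sum_add_distrib, Finset.sum_sub_distrib, ← Finset.sum_mul,
            ← Finset.mul_sum, hsum, ← hm]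
          ring
  have hVpos : 0 < ∑ j, z j / β * Real.exp ((y - z) j - m) := by
    have hj : ∃ j, 0 < z j / β := by
      by_contra! hc
      have := Finset.sum_nonpos (s := Finset.univ) fun j _ => hc j
      linarith
    obtain ⟨j, hj⟩ := hj
    exact Finset.sum_pos' (fun i _ => mul_nonneg (hz0 i) (Real.exp_pos _).le)
      ⟨j, Finset.mem_univ j, mul_pos hj (Real.exp_pos _)⟩
  have hlog := Real.log_le_sub_one_of_pos hVpos
  have hfin : Real.log (∑ j, z j / β * Real.exp ((y - z) j - m)) ≤
      (1 + (1 - ρ)) / 2 * (ρ / β * ‖y - z‖ ^ 2) := by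
    have := mul_le_mul_of_nonneg_left hvar (show 0 ≤ (1 + (1 - ρ)) / 2 by linarith)
    linarith
  have : (1 + (1 - ρ)) / 2 * (ρ / β * ‖y - z‖ ^ 2) - ‖y - z‖ ^ 2 / (2 * β) =
      -((1 - ρ) ^ 2 / (2 * β) * ‖y - z‖ ^ 2) := by
    field_simp
    ring
  linarith

/-- Existence of the ordered maximizers together with global quadratic decay away from them. -/
theorem exists_ordered_maximizers {q : ℕ} (hq : 2 ≤ q) {β : ℝ} (hβ : (q : ℝ) < β) :
    ∃ t d c : ℝ, 0 < t ∧ 0 < d ∧ 0 < c ∧ q * t + d = β ∧ aFix q β = (t + d) / β ∧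
      (∀ k y, pottsPhi q β y ≤ pottsPhi q β (orderedPt q t d k)) ∧
      ∀ k y, ∃ l, pottsPhi q β y ≤
        pottsPhi q β (orderedPt q t d k) - c * ‖y - orderedPt q t d l‖ ^ 2 := by
  have hq2 : (2 : ℝ) ≤ q := by exact_mod_cast hq
  have hβ0 : 0 < β := by linarith
  obtain ⟨z, hz⟩ := exists_pottsPhi_max hq hβ0
  obtain ⟨t, d, k₀, ht0, ht1, hd, hqt, hgap, hzeq⟩ := max_eq_orderedPt hq hβ hz
  have hmax : ∀ k y, pottsPhi q β y ≤ pottsPhi q β (orderedPt q t d k) := by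
    intro k y
    rw [pottsPhi_orderedPt β t d k k₀, ← hzeq]
    exact hz y
  obtain ⟨c₀, ε, hc₀, hε, hloc⟩ := pottsPhi_local hq hβ ht0 ht1 hd hqt hgap hmax
  have hnorm : ∀ k, ‖orderedPt q t d k‖ ≤ 2 * β := by
    intro k
    by_contra! hc
    exact (pottsPhi_lt_of_norm hq hβ0 hc).not_ge (hmax k 0)
  obtain ⟨c₁, hc₁, hmid⟩ : ∃ c₁ : ℝ, 0 < c₁ ∧ ∀ k y, ‖y‖ ≤ 4 * β →
      (∀ l, ε ≤ ‖y - orderedPt q t d l‖) →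
      pottsPhi q β y ≤ pottsPhi q β (orderedPt q t d k) - c₁ := by
    let K : Set (EuclideanSpace ℝ (Fin q)) :=
      Metric.closedBall 0 (4 * β) ∩ ⋂ l, {y | ε ≤ ‖y - orderedPt q t d l‖}
    have hK : IsCompact K := by
      refine (isCompact_closedBall _ _).inter_right (isClosed_iInter fun l => ?_)
      exact isClosed_le continuous_const (by fun_prop)
    have hmem : ∀ y, y ∈ K ↔ ‖y‖ ≤ 4 * β ∧ ∀ l, ε ≤ ‖y - orderedPt q t d l‖ := by
      intro y
      simp [K]
    by_cases hne : K.Nonempty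
    · obtain ⟨w, hw, hwmax⟩ := hK.exists_isMaxOn hne (continuous_pottsPhi hq β).continuousOn
      have hlt : pottsPhi q β w < pottsPhi q β (orderedPt q t d k₀) := by
        refine lt_of_le_of_ne (hmax k₀ w) fun heq => ?_
        have hwm : ∀ y, pottsPhi q β y ≤ pottsPhi q β w := fun y => heq ▸ hmax k₀ y
        obtain ⟨t', d', k', ht0', -, hd', hqt', hgap', hweq⟩ := max_eq_orderedPt hq hβ hwm
        have hdd : d' = d := gapFun_root_unique hβ hd' hd hgap' hgap
        have htt : t' = t := by
          subst hdd
          have : (q : ℝ) * t' = q * t := by linarith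
          exact mul_left_cancel₀ (by positivity) this
        have := ((hmem w).1 hw).2 k'
        rw [hweq, hdd, htt, sub_self, norm_zero] at this
        linarith
      refine ⟨_, sub_pos.2 hlt, fun k y hy1 hy2 => ?_⟩
      have := hwmax ((hmem y).2 ⟨hy1, hy2⟩)
      rw [pottsPhi_orderedPt β t d k k₀, sub_sub_cancel]
      exact this
    · exact ⟨1, one_pos, fun k y hy1 hy2 => (hne ⟨y, (hmem y).2 ⟨hy1, hy2⟩⟩).elim⟩
  refine ⟨t, d, min c₀ (min (c₁ / (6 * β) ^ 2) (1 / (16 * β))), ht0, hd, by positivity, hqt,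
    aFix_eq hq hβ hd hgap hqt ht0, hmax, ?_⟩
  intro k y
  have key : ∀ l (c : ℝ), min c₀ (min (c₁ / (6 * β) ^ 2) (1 / (16 * β))) ≤ c →
      pottsPhi q β y ≤ pottsPhi q β (orderedPt q t d k) - c * ‖y - orderedPt q t d l‖ ^ 2 →
      pottsPhi q β y ≤ pottsPhi q β (orderedPt q t d k) -
        min c₀ (min (c₁ / (6 * β) ^ 2) (1 / (16 * β))) * ‖y - orderedPt q t d l‖ ^ 2 := by
    intro l c hc h
    have := mul_le_mul_of_nonneg_right hc (sq_nonneg ‖y - orderedPt q t d l‖)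
    linarith
  by_cases hnear : ∃ l, ‖y - orderedPt q t d l‖ ≤ ε
  · obtain ⟨l, hl⟩ := hnear
    refine ⟨l, key l c₀ (min_le_left _ _) ?_⟩
    rw [pottsPhi_orderedPt β t d k l]
    exact hloc l y hl
  push Not at hnear
  refine ⟨k, ?_⟩
  by_cases hy : ‖y‖ ≤ 4 * β
  · refine key k _ ((min_le_right _ _).trans (min_le_left _ _)) ((hmid k y hy
      fun l => (hnear l).le).trans ?_)
    have h1 : ‖y - orderedPt q t d k‖ ≤ 6 * β := by
      linarith [norm_sub_le y (orderedPt q t d k), hnorm k]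
    have h2 : ‖y - orderedPt q t d k‖ ^ 2 ≤ (6 * β) ^ 2 := by gcongr
    have h3 : c₁ / (6 * β) ^ 2 * ‖y - orderedPt q t d k‖ ^ 2 ≤ c₁ / (6 * β) ^ 2 * (6 * β) ^ 2 := by
      gcongr
    rw [div_mul_cancel₀ _ (by positivity)] at h3
    linarith
  · push Not at hy
    refine key k _ ((min_le_right _ _).trans (min_le_right _ _)) ?_
    have h1 := pottsPhi_le hq β y
    have h2 := hmax k 0
    rw [pottsPhi_zero] at h2
    have h3 : ‖y - orderedPt q t d k‖ ≤ 2 * ‖y‖ := by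
      linarith [norm_sub_le y (orderedPt q t d k), hnorm k]
    have h4 : ‖y - orderedPt q t d k‖ ^ 2 ≤ (2 * ‖y‖) ^ 2 := by gcongr
    have h5 : 1 / (16 * β) * ‖y - orderedPt q t d k‖ ^ 2 ≤ 1 / (16 * β) * (2 * ‖y‖) ^ 2 := by
      gcongr
    have h6 : ‖y‖ ≤ ‖y‖ ^ 2 / (4 * β) := by
      rw [le_div_iff₀ (by positivity)]
      nlinarith
    have h7 : 1 / (16 * β) * (2 * ‖y‖) ^ 2 = ‖y‖ ^ 2 / (4 * β) := by field_simp; ring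
    have h8 : ‖y‖ ^ 2 / (2 * β) = 2 * (‖y‖ ^ 2 / (4 * β)) := by field_simp; ring
    linarith

/-- The Potts energy `Σ_j N_j ^ 2` of a configuration. -/
noncomputable def pottsEnergy {n q : ℕ} (σ : Conf n q) : ℝ := ∑ j, (cntN σ j : ℝ) ^ 2

theorem sum_exp_pow (n q : ℕ) (y : Fin q → ℝ) :
    (∑ j, Real.exp (y j)) ^ n = ∑ σ : Conf n q, Real.exp (∑ j, (cntN σ j : ℝ) * y j) := by
  have h1 : (∑ j, Real.exp (y j)) ^ n = ∏ _v : Fin n, ∑ j, Real.exp (y j) := by simp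
  rw [h1, Finset.prod_univ_sum, Fintype.piFinset_univ]
  refine Finset.sum_congr rfl fun σ _ => ?_
  rw [← Real.exp_sum]
  congr 1
  calc ∑ v, y (σ v) = ∑ v, ∑ j, if σ v = j then y j else 0 := by simp
    _ = _ := by
      rw [Finset.sum_comm]
      refine Finset.sum_congr rfl fun j _ => ?_
      rw [← Finset.sum_filter, Finset.sum_const, nsmul_eq_mul, cntN]

theorem gaussian_integrable {q : ℕ} {b : ℝ} (hb : 0 < b) (w : EuclideanSpace ℝ (Fin q)) :
    MeasureTheory.Integrable
      (fun y : EuclideanSpace ℝ (Fin q) => Real.exp (-b * ‖y - w‖ ^ 2)) := by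
  have h0 : MeasureTheory.Integrable
      (fun y : EuclideanSpace ℝ (Fin q) => Real.exp (-b * ‖y‖ ^ 2)) := by
    apply not_imp_comm.1 MeasureTheory.integral_undef
    rw [GaussianFourier.integral_rexp_neg_mul_sq_norm hb]
    positivity
  exact h0.comp_sub_right w

theorem gaussian_integral {q : ℕ} {b : ℝ} (hb : 0 < b) (w : EuclideanSpace ℝ (Fin q)) :
    ∫ y : EuclideanSpace ℝ (Fin q), Real.exp (-b * ‖y - w‖ ^ 2) =
      (Real.pi / b) ^ ((q : ℝ) / 2) := by
  rw [MeasureTheory.integral_sub_right_eq_self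
    (fun y : EuclideanSpace ℝ (Fin q) => Real.exp (-b * ‖y‖ ^ 2)) w,
    GaussianFourier.integral_rexp_neg_mul_sq_norm hb, finrank_euclideanSpace_fin]

theorem hubbard_integrand {n q : ℕ} {b : ℝ} (hb : 0 < b) (y : EuclideanSpace ℝ (Fin q)) :
    Real.exp (-b * ‖y‖ ^ 2) * (∑ j, Real.exp (y j)) ^ n =
      ∑ σ : Conf n q, Real.exp (pottsEnergy σ / (4 * b)) *
        Real.exp (-b * ‖y - WithLp.toLp 2 (fun j => (cntN σ j : ℝ) / (2 * b))‖ ^ 2) := by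
  rw [sum_exp_pow, Finset.mul_sum]
  refine Finset.sum_congr rfl fun σ _ => ?_
  rw [← Real.exp_add, ← Real.exp_add]
  congr 1
  simp only [EuclideanSpace.real_norm_sq_eq, pottsEnergy, PiLp.sub_apply, Finset.mul_sum,
    Finset.sum_div, ← Finset.sum_add_distrib]
  refine Finset.sum_congr rfl fun j _ => ?_
  field_simp
  ring

theorem hubbard_integrable (n : ℕ) {q : ℕ} {b : ℝ} (hb : 0 < b) :
    MeasureTheory.Integrable (fun y : EuclideanSpace ℝ (Fin q) =>
      Real.exp (-b * ‖y‖ ^ 2) * (∑ j, Real.exp (y j)) ^ n) := by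
  simp only [hubbard_integrand hb]
  exact MeasureTheory.integrable_finsetSum _ fun σ _ => (gaussian_integrable hb _).const_mul _

/-- The Hubbard–Stratonovich transform of the mean-field Potts partition function. -/
theorem hubbard_integral (n : ℕ) {q : ℕ} {b : ℝ} (hb : 0 < b) :
    ∫ y : EuclideanSpace ℝ (Fin q), Real.exp (-b * ‖y‖ ^ 2) * (∑ j, Real.exp (y j)) ^ n =
      (Real.pi / b) ^ ((q : ℝ) / 2) *
        ∑ σ : Conf n q, Real.exp (pottsEnergy σ / (4 * b)) := by
  simp only [hubbard_integrand hb]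
  rw [MeasureTheory.integral_finsetSum _ fun σ _ => (gaussian_integrable hb _).const_mul _]
  simp only [MeasureTheory.integral_const_mul, gaussian_integral hb, ← Finset.sum_mul]
  ring

theorem exp_mul_pottsPhi {q : ℕ} (hq : 2 ≤ q) (n : ℕ) (β : ℝ) (y : EuclideanSpace ℝ (Fin q)) :
    Real.exp (n * pottsPhi q β y) =
      Real.exp (-(n / (2 * β)) * ‖y‖ ^ 2) * (∑ j, Real.exp (y j)) ^ n := by
  have hS := sum_exp_pos hq y
  rw [pottsPhi, mul_sub, sub_eq_neg_add, Real.exp_add, Real.exp_nat_mul, Real.exp_log hS]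
  congr 2
  ring

/-- Laplace lower bound for the Potts partition function. -/
theorem partition_ge {q : ℕ} (hq : 2 ≤ q) {n : ℕ} (hn : 0 < n) {β : ℝ} (hβ : 0 < β)
    {z : EuclideanSpace ℝ (Fin q)} (hz : ∀ y, pottsPhi q β y ≤ pottsPhi q β z) :
    Real.exp (n * pottsPhi q β z) ≤ ∑ σ : Conf n q, Real.exp (β / (2 * n) * pottsEnergy σ) := by
  have hn0 : (0 : ℝ) < n := by exact_mod_cast hn
  have hb : 0 < (n : ℝ) / (2 * β) := by positivity
  have h := MeasureTheory.integral_mono ((gaussian_integrable hb z).const_mul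
    (Real.exp (n * pottsPhi q β z))) (hubbard_integrable n (q := q) hb) (fun y => by
      dsimp only
      rw [← exp_mul_pottsPhi hq, ← Real.exp_add]
      apply Real.exp_le_exp.2
      have := mul_le_mul_of_nonneg_left (pottsPhi_ge_of_max hq hβ hz y) hn0.le
      refine le_trans (le_of_eq ?_) this
      field_simp
      ring)
  rw [MeasureTheory.integral_const_mul, gaussian_integral hb, hubbard_integral n hb, mul_comm] at h
  have h2 := le_of_mul_le_mul_left h (by positivity)
  refine h2.trans (le_of_eq (Finset.sum_congr rfl fun σ _ => ?_))
  congr 1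
  field_simp
  ring

theorem abs_norm_sq_sub_le {q : ℕ} (y z : EuclideanSpace ℝ (Fin q)) :
    |‖y‖ ^ 2 - ‖z‖ ^ 2| ≤ ‖y - z‖ ^ 2 + 2 * ‖z‖ * ‖y - z‖ := by
  have h1 := abs_norm_sub_norm_le y z
  have h2 : ‖y‖ + ‖z‖ ≤ ‖y - z‖ + 2 * ‖z‖ := by
    linarith [le_abs_self (‖y‖ - ‖z‖)]
  rw [sq_sub_sq, abs_mul, abs_of_nonneg (by positivity)]
  calc (‖y‖ + ‖z‖) * |‖y‖ - ‖z‖| ≤ (‖y - z‖ + 2 * ‖z‖) * ‖y - z‖ := by gcongr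
    _ = _ := by ring

/-- Laplace upper bound for the Potts partition function at a perturbed inverse temperature. -/
theorem partition_le {q : ℕ} (hq : 2 ≤ q) {n : ℕ} (hn : 0 < n) {β τ c t d : ℝ} (hβ : 0 < β)
    (hc : 0 < c) (hβτ : β / 2 ≤ β + τ) (hτ : n * τ ^ 2 = 1)
    (hnc : 4 ≤ c * β ^ 2 * Real.sqrt n) (k : Fin q)
    (hup : ∀ y, ∃ l, pottsPhi q β y ≤
        pottsPhi q β (orderedPt q t d k) - c * ‖y - orderedPt q t d l‖ ^ 2) :
    (∑ σ : Conf n q, Real.exp ((β + τ) / (2 * n) * pottsEnergy σ)) *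
        Real.exp (-(τ / (2 * n) * (n ^ 2 * (‖orderedPt q t d k‖ ^ 2 / β ^ 2)))) ≤
      (2 / (β * c)) ^ ((q : ℝ) / 2) * q *
        Real.exp (4 * ‖orderedPt q t d k‖ ^ 2 / (c * β ^ 4)) *
        Real.exp (n * pottsPhi q β (orderedPt q t d k)) := by
  have hn0 : (0 : ℝ) < n := by exact_mod_cast hn
  have hβ' : 0 < β + τ := by linarith
  set β' := β + τ with hβ'def
  set z := orderedPt q t d k with hz
  set r := ‖z‖ with hr
  have hr0 : 0 ≤ r := norm_nonneg _
  have hrl : ∀ l, ‖orderedPt q t d l‖ = r := by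
    intro l
    rw [hr, hz, ← sq_eq_sq₀ (norm_nonneg _) (norm_nonneg _), EuclideanSpace.real_norm_sq_eq,
      EuclideanSpace.real_norm_sq_eq, sum_orderedPt _ _ _ (fun x => x ^ 2),
      sum_orderedPt _ _ _ (fun x => x ^ 2)]
  set s := Real.sqrt n with hs
  have hs0 : 0 < s := Real.sqrt_pos.2 hn0
  have hss : s ^ 2 = n := Real.sq_sqrt hn0.le
  have hτs : |τ| * s = 1 := by
    have : (|τ| * s) ^ 2 = 1 := by rw [mul_pow, sq_abs, hss]; linarith
    exact (pow_eq_one_iff_of_nonneg (by positivity) two_ne_zero).1 this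
  have hb' : 0 < (n : ℝ) / (2 * β') := by positivity
  set κ := n * τ / (2 * β * β') with hκ
  have hκabs : |κ| ≤ s / β ^ 2 := by
    rw [hκ, abs_div, abs_mul, abs_of_pos hn0, abs_of_pos (show 0 < 2 * β * β' by positivity),
      ← hss,
      div_le_div_iff₀ (by positivity) (by positivity)]
    calc s ^ 2 * |τ| * β ^ 2 = s * (|τ| * s) * β ^ 2 := by ring
      _ = s * (β * β) := by rw [hτs]; ring
      _ ≤ s * (2 * β * β') := mul_le_mul_of_nonneg_left (by nlinarith) hs0.le
  set Φ := pottsPhi q β z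
  set K := 4 * r ^ 2 / (c * β ^ 4) with hK
  have hb2 : 0 < (n : ℝ) * c / 2 := by positivity
  have hpt : ∀ y : EuclideanSpace ℝ (Fin q),
      Real.exp (-(n / (2 * β')) * ‖y‖ ^ 2) * (∑ j, Real.exp (y j)) ^ n ≤
        Real.exp (n * Φ + κ * r ^ 2 + K) *
          ∑ l, Real.exp (-(n * c / 2) * ‖y - orderedPt q t d l‖ ^ 2) := by
    intro y
    obtain ⟨l, hl⟩ := hup y
    have h1 : Real.exp (-(n / (2 * β')) * ‖y‖ ^ 2) * (∑ j, Real.exp (y j)) ^ n =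
        Real.exp (n * pottsPhi q β y + κ * ‖y‖ ^ 2) := by
      rw [Real.exp_add, exp_mul_pottsPhi hq, mul_right_comm, ← Real.exp_add]
      congr 2
      rw [hκ, show τ = β' - β by rw [hβ'def]; ring]
      field_simp
      ring
    rw [h1]
    have h2 : Real.exp (-(n * c / 2) * ‖y - orderedPt q t d l‖ ^ 2) ≤
        ∑ l, Real.exp (-(n * c / 2) * ‖y - orderedPt q t d l‖ ^ 2) :=
      Finset.single_le_sum (f := fun l => Real.exp (-(n * c / 2) * ‖y - orderedPt q t d l‖ ^ 2))
        (fun _ _ => (Real.exp_pos _).le) (Finset.mem_univ l)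
    refine le_trans ?_ (mul_le_mul_of_nonneg_left h2 (Real.exp_pos _).le)
    rw [← Real.exp_add]
    apply Real.exp_le_exp.2
    have h3 := abs_norm_sq_sub_le y (orderedPt q t d l)
    rw [hrl] at h3
    set D := ‖y - orderedPt q t d l‖
    have h4 : κ * (‖y‖ ^ 2 - r ^ 2) ≤ s / β ^ 2 * (D ^ 2 + 2 * r * D) := by
      calc κ * (‖y‖ ^ 2 - r ^ 2) ≤ |κ| * |‖y‖ ^ 2 - r ^ 2| := by
            rw [← abs_mul]; exact le_abs_self _
        _ ≤ _ := by gcongr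
    have h5 : s / β ^ 2 * D ^ 2 ≤ n * c / 4 * D ^ 2 := by
      refine mul_le_mul_of_nonneg_right ?_ (sq_nonneg D)
      rw [div_le_div_iff₀ (by positivity) (by norm_num), ← hss]
      nlinarith
    have h6 : s / β ^ 2 * (2 * r * D) ≤ n * c / 4 * D ^ 2 + K := by
      have h7 : n * c / 4 * D ^ 2 + K - s / β ^ 2 * (2 * r * D) =
          c / 4 * (s * D - 4 * r / (c * β ^ 2)) ^ 2 := by
        rw [hK, ← hss]
        field_simp
        ring
      have : 0 ≤ c / 4 * (s * D - 4 * r / (c * β ^ 2)) ^ 2 := by positivity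
      linarith
    have h8 := mul_le_mul_of_nonneg_left hl hn0.le
    linarith
  have hint := MeasureTheory.integral_mono (hubbard_integrable n hb')
    ((MeasureTheory.integrable_finsetSum Finset.univ fun l _ =>
      gaussian_integrable hb2 (orderedPt q t d l)).const_mul
      (Real.exp (n * Φ + κ * r ^ 2 + K))) hpt
  rw [MeasureTheory.integral_const_mul, MeasureTheory.integral_finsetSum _ fun l _ =>
      gaussian_integrable hb2 (orderedPt q t d l), hubbard_integral n hb'] at hint
  simp only [gaussian_integral hb2, Finset.sum_const, Finset.card_univ, Fintype.card_fin,
    nsmul_eq_mul] at hint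
  have hZ : ∑ σ : Conf n q, Real.exp (pottsEnergy σ / (4 * (n / (2 * β')))) =
      ∑ σ : Conf n q, Real.exp (β' / (2 * n) * pottsEnergy σ) := by
    refine Finset.sum_congr rfl fun σ _ => ?_
    congr 1
    field_simp
    ring
  rw [hZ] at hint
  set Z := ∑ σ : Conf n q, Real.exp (β' / (2 * n) * pottsEnergy σ)
  have hpow : (Real.pi / (n * c / 2)) ^ ((q : ℝ) / 2) ≤
      (Real.pi / (n / (2 * β'))) ^ ((q : ℝ) / 2) * (2 / (β * c)) ^ ((q : ℝ) / 2) := by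
    rw [← Real.mul_rpow (by positivity) (by positivity)]
    apply Real.rpow_le_rpow (by positivity) _ (by positivity)
    have : Real.pi / (n / (2 * β')) * (2 / (β * c)) = Real.pi / (n * c / 2) * (2 * β' / β) := by
      field_simp
    rw [this]
    apply le_mul_of_one_le_right (by positivity)
    rw [le_div_iff₀ hβ]
    linarith
  have hP : 0 < (Real.pi / (n / (2 * β'))) ^ ((q : ℝ) / 2) := by positivity
  have hZle : Z ≤ (2 / (β * c)) ^ ((q : ℝ) / 2) * q * Real.exp (n * Φ + κ * r ^ 2 + K) := by
    refine le_of_mul_le_mul_left (hint.trans ?_) hP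
    calc Real.exp (n * Φ + κ * r ^ 2 + K) * (q * (Real.pi / (n * c / 2)) ^ ((q : ℝ) / 2))
        ≤ Real.exp (n * Φ + κ * r ^ 2 + K) * (q *
          ((Real.pi / (n / (2 * β'))) ^ ((q : ℝ) / 2) * (2 / (β * c)) ^ ((q : ℝ) / 2))) := by
          gcongr
      _ = _ := by ring
  have hexp : n * Φ + κ * r ^ 2 + K + -(τ / (2 * n) * (n ^ 2 * (r ^ 2 / β ^ 2))) ≤ K + n * Φ := by
    have : κ * r ^ 2 + -(τ / (2 * n) * (n ^ 2 * (r ^ 2 / β ^ 2))) =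
        -(n * τ ^ 2 * r ^ 2 / (2 * β ^ 2 * β')) := by
      rw [hκ, show τ = β' - β by rw [hβ'def]; ring]
      field_simp
      ring
    have h2 : 0 ≤ n * τ ^ 2 * r ^ 2 / (2 * β ^ 2 * β') := by positivity
    linarith
  calc Z * Real.exp (-(τ / (2 * n) * (n ^ 2 * (r ^ 2 / β ^ 2))))
      ≤ (2 / (β * c)) ^ ((q : ℝ) / 2) * q * Real.exp (n * Φ + κ * r ^ 2 + K) *
        Real.exp (-(τ / (2 * n) * (n ^ 2 * (r ^ 2 / β ^ 2)))) := by gcongr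
    _ = (2 / (β * c)) ^ ((q : ℝ) / 2) * q * Real.exp (n * Φ + κ * r ^ 2 + K +
        -(τ / (2 * n) * (n ^ 2 * (r ^ 2 / β ^ 2)))) := by rw [mul_assoc, ← Real.exp_add]
    _ ≤ (2 / (β * c)) ^ ((q : ℝ) / 2) * q * Real.exp (K + n * Φ) := by gcongr
    _ = _ := by rw [Real.exp_add]; ring

/-- The energy of the mean-field Potts model has fluctuations of order `n ^ (3 / 2)`. -/
theorem potts_second_moment {q : ℕ} (hq : 2 ≤ q) {β : ℝ} (hβ : (q : ℝ) < β) :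
    0 < (aFix q β * q - 1) / ((q : ℝ) - 1) ∧
    ∃ C : ℝ, 0 < C ∧ ∃ N : ℕ, ∀ n : ℕ, N ≤ n →
      ∑ σ : Conf n q, Real.exp (β / (2 * n) * pottsEnergy σ) *
        (pottsEnergy σ - n ^ 2 * (1 / q +
          (1 - 1 / q) * ((aFix q β * q - 1) / ((q : ℝ) - 1)) ^ 2)) ^ 2 ≤
      C * n ^ 3 * ∑ σ : Conf n q, Real.exp (β / (2 * n) * pottsEnergy σ) := by
  have hq2 : (2 : ℝ) ≤ q := by exact_mod_cast hq
  have hβ0 : 0 < β := by linarith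
  obtain ⟨t, d, c, ht0, hd, hc, hqt, ha, hmax, hup⟩ := exists_ordered_maximizers hq hβ
  have hθ : (aFix q β * q - 1) / ((q : ℝ) - 1) = d / β := by
    rw [ha]
    have : (q : ℝ) - 1 ≠ 0 := by linarith
    field_simp
    rw [← hqt]
    ring
  let k : Fin q := ⟨0, by omega⟩
  have hnorm : ‖orderedPt q t d k‖ ^ 2 / β ^ 2 = 1 / q + (1 - 1 / q) * (d / β) ^ 2 := by
    rw [EuclideanSpace.real_norm_sq_eq, sum_orderedPt _ _ _ (fun x => x ^ 2)]
    field_simp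
    rw [← hqt]
    ring
  rw [hθ, ← hnorm]
  refine ⟨by positivity, ?_⟩
  set z := orderedPt q t d k with hz
  set M := (2 / (β * c)) ^ ((q : ℝ) / 2) * q * Real.exp (4 * ‖z‖ ^ 2 / (c * β ^ 4)) with hM
  have hM0 : 0 < M := by positivity
  refine ⟨8 * M, by positivity,
    ⌈max 1 (max ((2 / β) ^ 2) ((4 / (c * β ^ 2)) ^ 2))⌉₊, fun n hn => ?_⟩
  have hn' := Nat.le_of_ceil_le hn
  have hn1 : (1 : ℝ) ≤ n := (le_max_left _ _).trans hn'
  have hn2 : (2 / β) ^ 2 ≤ n := (le_max_left _ _).trans ((le_max_right _ _).trans hn')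
  have hn3 : (4 / (c * β ^ 2)) ^ 2 ≤ n := (le_max_right _ _).trans ((le_max_right _ _).trans hn')
  have hn0 : (0 : ℝ) < n := by linarith
  have hnpos : 0 < n := by exact_mod_cast hn0
  set s := Real.sqrt n with hs
  have hs0 : 0 < s := Real.sqrt_pos.2 hn0
  have hss : s ^ 2 = n := Real.sq_sqrt hn0.le
  have hs2 : 2 / β ≤ s := Real.le_sqrt_of_sq_le hn2
  have hs3 : 4 / (c * β ^ 2) ≤ s := Real.le_sqrt_of_sq_le hn3
  have hsβ : 1 / s ≤ β / 2 := by
    rw [div_le_iff₀ hβ0] at hs2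
    rw [div_le_iff₀ hs0]
    linarith
  have hsc : 4 ≤ c * β ^ 2 * s := by
    rw [div_le_iff₀ (by positivity)] at hs3
    linarith
  have hs1 : 0 < 1 / s := by positivity
  have hlow := partition_ge hq hnpos hβ0 (hmax k)
  have hp := partition_le hq hnpos (τ := 1 / s) hβ0 hc (by linarith)
    (by rw [← hss]; field_simp) hsc k (hup k)
  have hm := partition_le hq hnpos (τ := -(1 / s)) hβ0 hc (by linarith)
    (by rw [← hss]; field_simp) hsc k (hup k)
  rw [← hz, ← hM] at hp hm
  rw [← hz] at hlow
  set h := ‖z‖ ^ 2 / β ^ 2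
  set Z := ∑ σ : Conf n q, Real.exp (β / (2 * n) * pottsEnergy σ)
  have hML := mul_le_mul_of_nonneg_left hlow hM0.le
  have hterm : ∀ σ : Conf n q, Real.exp (β / (2 * n) * pottsEnergy σ) *
      (pottsEnergy σ - n ^ 2 * h) ^ 2 ≤ 4 * n ^ 3 *
        (Real.exp ((β + 1 / s) / (2 * n) * pottsEnergy σ) *
            Real.exp (-(1 / s / (2 * n) * (n ^ 2 * h))) +
          Real.exp ((β + -(1 / s)) / (2 * n) * pottsEnergy σ) *
            Real.exp (-(-(1 / s) / (2 * n) * (n ^ 2 * h)))) := by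
    intro σ
    set x := (1 / s) / (2 * n) * (pottsEnergy σ - n ^ 2 * h) with hx
    have hx2 : (pottsEnergy σ - n ^ 2 * h) ^ 2 = 4 * n ^ 3 * x ^ 2 := by
      rw [hx, ← hss]
      field_simp
      ring
    have e1 : Real.exp ((β + 1 / s) / (2 * n) * pottsEnergy σ) *
        Real.exp (-(1 / s / (2 * n) * (n ^ 2 * h))) =
        Real.exp (β / (2 * n) * pottsEnergy σ) * Real.exp x := by
      rw [← Real.exp_add, ← Real.exp_add, hx]
      ring_nf
    have e2 : Real.exp ((β + -(1 / s)) / (2 * n) * pottsEnergy σ) *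
        Real.exp (-(-(1 / s) / (2 * n) * (n ^ 2 * h))) =
        Real.exp (β / (2 * n) * pottsEnergy σ) * Real.exp (-x) := by
      rw [← Real.exp_add, ← Real.exp_add, hx]
      ring_nf
    rw [e1, e2, hx2, ← mul_add]
    have := sq_le_exp_add_exp_neg x
    calc Real.exp (β / (2 * n) * pottsEnergy σ) * (4 * n ^ 3 * x ^ 2)
        = 4 * n ^ 3 * (Real.exp (β / (2 * n) * pottsEnergy σ) * x ^ 2) := by ring
      _ ≤ _ := by
        gcongr
        linarith
  refine (Finset.sum_le_sum fun σ _ => hterm σ).trans ?_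
  rw [← Finset.mul_sum, Finset.sum_add_distrib, ← Finset.sum_mul, ← Finset.sum_mul]
  calc _ ≤ 4 * (n : ℝ) ^ 3 * (M * Z + M * Z) := by
        exact mul_le_mul_of_nonneg_left (add_le_add (hp.trans hML) (hm.trans hML))
          (by positivity)
    _ = _ := by ring

/-- Signed deviation of the total weight with colour `j` from its mean. -/
noncomputable def colourDev {ι : Type*} [Fintype ι] {q : ℕ} (w : ι → ℝ) (κ : ι → Fin q)
    (j : Fin q) : ℝ :=
  ∑ i, w i * ((if κ i = j then 1 else 0) - 1 / q)

theorem sum_colourDev {ι : Type*} [Fintype ι] {q : ℕ} (hq : 2 ≤ q) (w : ι → ℝ)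
    (κ : ι → Fin q) : ∑ j, colourDev w κ j = 0 := by
  have hq0 : (q : ℝ) ≠ 0 := by positivity
  simp only [colourDev]
  rw [Finset.sum_comm]
  refine Finset.sum_eq_zero fun i _ => ?_
  rw [← Finset.mul_sum, Finset.sum_sub_distrib]
  simp [hq0]

theorem colourDev_cons {k q : ℕ} (w : Fin (k + 1) → ℝ) (x : Fin q) (κ : Fin k → Fin q)
    (j : Fin q) : colourDev w (Fin.cons x κ : Fin (k + 1) → Fin q) j =
      colourDev (fun i => w i.succ) κ j + w 0 * ((if x = j then 1 else 0) - 1 / q) := by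
  simp only [colourDev, Fin.sum_univ_succ, Fin.cons_zero, Fin.cons_succ]
  ring

theorem sum_sq_add_indicator {q : ℕ} (hq : 2 ≤ q) (D : Fin q → ℝ) (hD : ∑ j, D j = 0)
    (l : ℝ) (x : Fin q) :
    ∑ j, (D j + l * ((if x = j then 1 else 0) - 1 / q)) ^ 2 =
      ∑ j, D j ^ 2 + l ^ 2 * (1 - 1 / q) + 2 * l * D x := by
  have hq0 : (q : ℝ) ≠ 0 := by positivity
  have h : ∀ j, (D j + l * ((if x = j then 1 else 0) - 1 / q)) ^ 2 =
      D j ^ 2 + (if x = j then 2 * l * D j + l ^ 2 * (1 - 2 / q) else 0)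
        - 2 * l / q * D j + l ^ 2 / q ^ 2 := by
    intro j
    split_ifs <;> field_simp <;> ring
  simp only [h, Finset.sum_add_distrib, Finset.sum_sub_distrib, ← Finset.mul_sum, hD,
    Finset.sum_ite_eq, Finset.mem_univ, if_true, Finset.sum_const, Finset.card_univ,
    Fintype.card_fin, nsmul_eq_mul]
  field_simp
  ring

theorem sum_fin_cons {k q : ℕ} (f : (Fin (k + 1) → Fin q) → ℝ) :
    ∑ κ, f κ = ∑ κ : Fin k → Fin q, ∑ x : Fin q, f (Fin.cons x κ : Fin (k + 1) → Fin q) := by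
  rw [← (Fin.consEquiv (fun _ => Fin q)).sum_comp, Fintype.sum_prod_type, Finset.sum_comm]
  rfl

/-- First two moments of the squared deviation of a uniformly random colouring. -/
theorem colourDev_moments_fin {q : ℕ} (hq : 2 ≤ q) (k : ℕ) (w : Fin k → ℝ) :
    ∑ κ : Fin k → Fin q, ∑ j, colourDev w κ j ^ 2 = (q : ℝ) ^ k * ((1 - 1 / q) * ∑ i, w i ^ 2) ∧
    ∑ κ : Fin k → Fin q, (∑ j, colourDev w κ j ^ 2) ^ 2 =
      (q : ℝ) ^ k * (((1 - 1 / q) * ∑ i, w i ^ 2) ^ 2 +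
        2 * (1 - 1 / q) / q * ((∑ i, w i ^ 2) ^ 2 - ∑ i, w i ^ 4)) := by
  have hq0 : (q : ℝ) ≠ 0 := by positivity
  induction k with
  | zero => simp [colourDev]
  | succ k ih =>
    obtain ⟨ih1, ih2⟩ := ih (fun i => w i.succ)
    have hD := fun κ : Fin k → Fin q => sum_colourDev hq (fun i => w i.succ) κ
    have key := fun (κ : Fin k → Fin q) (x : Fin q) =>
      sum_sq_add_indicator hq (colourDev (fun i => w i.succ) κ) (hD κ) (w 0) x
    have h1 : ∀ κ : Fin k → Fin q, ∑ x, (∑ j, colourDev (fun i => w i.succ) κ j ^ 2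
        + w 0 ^ 2 * (1 - 1 / q) + 2 * w 0 * colourDev (fun i => w i.succ) κ x) =
        q * ∑ j, colourDev (fun i => w i.succ) κ j ^ 2 + q * (w 0 ^ 2 * (1 - 1 / q)) := by
      intro κ
      rw [Finset.sum_add_distrib, ← Finset.mul_sum, hD]
      simp
    have h2 : ∀ κ : Fin k → Fin q, ∑ x, (∑ j, colourDev (fun i => w i.succ) κ j ^ 2
        + w 0 ^ 2 * (1 - 1 / q) + 2 * w 0 * colourDev (fun i => w i.succ) κ x) ^ 2 =
        q * (∑ j, colourDev (fun i => w i.succ) κ j ^ 2) ^ 2 +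
        (2 * q * (w 0 ^ 2 * (1 - 1 / q)) + 4 * w 0 ^ 2) *
          ∑ j, colourDev (fun i => w i.succ) κ j ^ 2 + q * (w 0 ^ 2 * (1 - 1 / q)) ^ 2 := by
      intro κ
      set A := ∑ j, colourDev (fun i => w i.succ) κ j ^ 2 with hA
      have : ∀ x, (A + w 0 ^ 2 * (1 - 1 / q) + 2 * w 0 * colourDev (fun i => w i.succ) κ x) ^ 2 =
          (A + w 0 ^ 2 * (1 - 1 / q)) ^ 2 + 4 * w 0 * (A + w 0 ^ 2 * (1 - 1 / q)) *
            colourDev (fun i => w i.succ) κ x +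
            4 * w 0 ^ 2 * colourDev (fun i => w i.succ) κ x ^ 2 := fun x => by ring
      simp only [this]
      rw [Finset.sum_add_distrib, Finset.sum_add_distrib, ← Finset.mul_sum, ← Finset.mul_sum, hD,
        ← hA]
      simp
      ring
    constructor
    · rw [sum_fin_cons]
      simp only [colourDev_cons, key, h1]
      rw [Finset.sum_add_distrib, ← Finset.mul_sum, ih1, Fin.sum_univ_succ]
      simp
      ring
    · rw [sum_fin_cons]
      simp only [colourDev_cons, key, h2]
      rw [Finset.sum_add_distrib, Finset.sum_add_distrib, ← Finset.mul_sum, ← Finset.mul_sum,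
        ih1, ih2, Fin.sum_univ_succ, Fin.sum_univ_succ]
      simp
      field_simp
      ring

theorem colourDev_second_moment {ι : Type*} [Fintype ι] {q : ℕ} (hq : 2 ≤ q) (w : ι → ℝ) (h : ℝ) :
    ∑ κ : ι → Fin q, (∑ j, colourDev w κ j ^ 2 - h) ^ 2 =
      (q : ℝ) ^ Fintype.card ι * (((1 - 1 / q) * ∑ i, w i ^ 2 - h) ^ 2 +
        2 * (1 - 1 / q) / q * ((∑ i, w i ^ 2) ^ 2 - ∑ i, w i ^ 4)) := by
  let e := Fintype.equivFin ι
  obtain ⟨h1, h2⟩ := colourDev_moments_fin hq (Fintype.card ι) (fun i => w (e.symm i))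
  rw [e.symm.sum_comp (fun i => w i ^ 2)] at h1 h2
  rw [e.symm.sum_comp (fun i => w i ^ 4)] at h2
  have hdev : ∀ (κ : ι → Fin q) j, colourDev w κ j =
      colourDev (fun i => w (e.symm i)) (e.arrowCongr (Equiv.refl _) κ) j := by
    intro κ j
    simp only [colourDev, Equiv.arrowCongr_apply, Equiv.coe_refl, Function.comp_apply, id]
    exact (e.symm.sum_comp (fun i => w i * ((if κ i = j then (1 : ℝ) else 0) - 1 / q))).symm
  simp only [hdev]
  rw [(e.arrowCongr (Equiv.refl (Fin q))).sum_comp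
    (fun κ => (∑ j, colourDev (fun i => w (e.symm i)) κ j ^ 2 - h) ^ 2)]
  simp only [sub_sq, Finset.sum_add_distrib, Finset.sum_sub_distrib, ← Finset.sum_mul,
    ← Finset.mul_sum, h1, h2]
  simp
  ring

theorem compCard_le_L1 {n : ℕ} (E : Finset (Fin n × Fin n)) (v : Fin n) :
    compCard E v ≤ L1 E :=
  Finset.le_sup (f := fun v => compCard E v) (Finset.mem_univ v)

/-- Size of a connected component. -/
noncomputable def compSize {n : ℕ} (E : Finset (Fin n × Fin n))
    (c : (graphOf E).ConnectedComponent) : ℝ :=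
  ((Finset.univ.filter (fun u => (graphOf E).connectedComponentMk u = c)).card : ℝ)

theorem compSize_mk {n : ℕ} (E : Finset (Fin n × Fin n)) (v : Fin n) :
    compSize E ((graphOf E).connectedComponentMk v) = compCard E v := by
  rw [compSize, compCard]
  congr 2
  ext u
  simp [SimpleGraph.ConnectedComponent.eq, SimpleGraph.reachable_comm]

theorem sum_compSize_mul {n : ℕ} (E : Finset (Fin n × Fin n))
    (f : (graphOf E).ConnectedComponent → ℝ) :
    ∑ c, compSize E c * f c = ∑ v, f ((graphOf E).connectedComponentMk v) := by
  rw [← Finset.sum_fiberwise' Finset.univ (graphOf E).connectedComponentMk f]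
  simp [compSize]

theorem sum_compSize_sq {n : ℕ} (E : Finset (Fin n × Fin n)) :
    ∑ c, compSize E c ^ 2 = sumCompSq E := by
  simp only [pow_two, sum_compSize_mul E (compSize E), compSize_mk, sumCompSq, Nat.cast_sum]

theorem sum_compSize_pow_four_le {n : ℕ} (E : Finset (Fin n × Fin n)) :
    ∑ c, compSize E c ^ 4 ≤ (L1 E : ℝ) ^ 2 * sumCompSq E := by
  rw [← sum_compSize_sq, Finset.mul_sum]
  refine Finset.sum_le_sum fun c _ => ?_
  have h : compSize E c ≤ L1 E := by
    induction c using SimpleGraph.ConnectedComponent.ind with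
    | h v =>
      rw [compSize_mk]
      exact_mod_cast compCard_le_L1 E v
  have h0 : 0 ≤ compSize E c := Nat.cast_nonneg _
  calc compSize E c ^ 4 = compSize E c ^ 2 * compSize E c ^ 2 := by ring
    _ ≤ _ := by gcongr

theorem L1_sq_le_sumCompSq {n : ℕ} (E : Finset (Fin n × Fin n)) :
    (L1 E : ℝ) ^ 2 ≤ sumCompSq E := by
  rcases Nat.eq_zero_or_pos n with rfl | hn
  · simp [L1]
  · obtain ⟨v, -, hv⟩ := Finset.exists_mem_eq_sup (Finset.univ : Finset (Fin n)) ⟨⟨0, hn⟩, by simp⟩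
      (fun v => compCard E v)
    rw [← sum_compSize_sq, L1, hv, ← compSize_mk]
    exact Finset.single_le_sum (f := fun c => compSize E c ^ 2) (fun _ _ => sq_nonneg _)
      (Finset.mem_univ _)

theorem graphOf_adj_of_mem {n : ℕ} {E : Finset (Fin n × Fin n)} (hE : E ⊆ allPairs n)
    {e : Fin n × Fin n} (he : e ∈ E) : (graphOf E).Adj e.1 e.2 := by
  have h := hE he
  simp only [allPairs, Finset.mem_filter, Finset.mem_univ, true_and] at h
  rw [graphOf, SimpleGraph.fromRel_adj]
  exact ⟨h.ne, Or.inl he⟩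

/-- A configuration whose monochromatic pairs contain `E` is constant on components. -/
theorem eq_of_walk {n q : ℕ} {E : Finset (Fin n × Fin n)} {σ : Conf n q}
    (h : E ⊆ monoPairs σ) {u v : Fin n} (p : (graphOf E).Walk u v) : σ u = σ v := by
  induction p with
  | nil => rfl
  | cons hadj _ ih =>
    rw [graphOf, SimpleGraph.fromRel_adj] at hadj
    refine Eq.trans ?_ ih
    rcases hadj.2 with h1 | h1
    · exact (Finset.mem_filter.1 (h h1)).2.2
    · exact (Finset.mem_filter.1 (h h1)).2.2.symm

/-- Configurations compatible with `E` correspond to colourings of the components. -/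
theorem sum_compatible {n q : ℕ} {E : Finset (Fin n × Fin n)} (hE : E ⊆ allPairs n)
    (f : Conf n q → ℝ) :
    ∑ σ with E ⊆ monoPairs σ, f σ =
      ∑ κ : (graphOf E).ConnectedComponent → Fin q,
        f (fun v => κ ((graphOf E).connectedComponentMk v)) := by
  symm
  refine Finset.sum_bij (fun κ _ v => κ ((graphOf E).connectedComponentMk v)) ?_ ?_ ?_ ?_
  · intro κ _
    refine Finset.mem_filter.2 ⟨Finset.mem_univ _, fun e he => ?_⟩
    refine Finset.mem_filter.2 ⟨Finset.mem_univ _, (Finset.mem_filter.1 (hE he)).2, ?_⟩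
    exact congrArg κ (SimpleGraph.ConnectedComponent.eq.2 (graphOf_adj_of_mem hE he).reachable)
  · intro κ _ κ' _ h
    funext c
    induction c using SimpleGraph.ConnectedComponent.ind with
    | h v => exact congrFun h v
  · intro σ hσ
    exact ⟨SimpleGraph.ConnectedComponent.lift σ
      fun _ _ p _ => eq_of_walk (Finset.mem_filter.1 hσ).2 p, Finset.mem_univ _, rfl⟩
  · intro _ _
    rfl

theorem sum_cntN {n q : ℕ} (σ : Conf n q) : ∑ j, (cntN σ j : ℝ) = n := by
  have h := Finset.card_eq_sum_card_fiberwise (f := σ) (s := Finset.univ) (t := Finset.univ)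
    (fun _ _ => by simp)
  rw [Finset.card_univ, Fintype.card_fin] at h
  conv_rhs => rw [h]
  simp [cntN]

theorem colourDev_compSize {n q : ℕ} (E : Finset (Fin n × Fin n))
    (κ : (graphOf E).ConnectedComponent → Fin q) (j : Fin q) :
    colourDev (compSize E) κ j =
      cntN (fun v => κ ((graphOf E).connectedComponentMk v)) j - (n : ℝ) / q := by
  rw [colourDev, sum_compSize_mul E (fun c => (if κ c = j then 1 else 0) - 1 / (q : ℝ)),
    Finset.sum_sub_distrib]
  simp [cntN, div_eq_mul_inv]

theorem sum_sq_colourDev_compSize {n q : ℕ} (hq : 2 ≤ q) (E : Finset (Fin n × Fin n))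
    (κ : (graphOf E).ConnectedComponent → Fin q) :
    ∑ j, colourDev (compSize E) κ j ^ 2 =
      pottsEnergy (fun v => κ ((graphOf E).connectedComponentMk v)) - (n : ℝ) ^ 2 / q := by
  have hq0 : (q : ℝ) ≠ 0 := by positivity
  simp only [colourDev_compSize, pottsEnergy, sub_sq]
  rw [Finset.sum_add_distrib, Finset.sum_sub_distrib, ← Finset.sum_mul, ← Finset.mul_sum,
    sum_cntN]
  simp
  field_simp
  ring

theorem compatible_second_moment_ge {n q : ℕ} (hq : 2 ≤ q) {E : Finset (Fin n × Fin n)}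
    (hE : E ⊆ allPairs n) (h : ℝ) :
    (q : ℝ) ^ numComps E * (((1 - 1 / q) * sumCompSq E - h) ^ 2 +
        2 * (1 - 1 / q) / q * (sumCompSq E * (sumCompSq E - (L1 E : ℝ) ^ 2))) ≤
      ∑ σ : Conf n q with E ⊆ monoPairs σ, (pottsEnergy σ - ((n : ℝ) ^ 2 / q + h)) ^ 2 := by
  have hq2 : (2 : ℝ) ≤ q := by exact_mod_cast hq
  have hc : 0 ≤ 1 - 1 / (q : ℝ) := by
    rw [sub_nonneg, div_le_one (by positivity)]
    linarith
  have key := colourDev_second_moment hq (compSize E) h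
  simp only [sum_sq_colourDev_compSize hq] at key
  rw [sum_compatible hE]
  simp only [← sub_sub]
  rw [key, sum_compSize_sq, numComps, Nat.card_eq_fintype_card]
  have := sum_compSize_pow_four_le E
  gcongr
  linarith

theorem compatible_card {n q : ℕ} {E : Finset (Fin n × Fin n)} (hE : E ⊆ allPairs n) :
    ∑ σ : Conf n q with E ⊆ monoPairs σ, (1 : ℝ) = (q : ℝ) ^ numComps E := by
  rw [sum_compatible hE]
  simp [numComps, Nat.card_eq_fintype_card]

theorem monoPairs_subset {n q : ℕ} (σ : Conf n q) : monoPairs σ ⊆ allPairs n := fun _ he =>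
  Finset.mem_filter.2 ⟨Finset.mem_univ _, (Finset.mem_filter.1 he).2.1⟩

theorem pottsEnergy_eq {n q : ℕ} (σ : Conf n q) :
    pottsEnergy σ = 2 * (monoPairs σ).card + n := by
  have h1 : pottsEnergy σ =
      ∑ u, ∑ v, if σ u = σ v then (1 : ℝ) else 0 := by
    have : ∀ j, (cntN σ j : ℝ) = ∑ v, if σ v = j then (1 : ℝ) else 0 := by
      intro j
      simp [cntN]
    simp only [pottsEnergy, this, pow_two, Finset.sum_mul_sum]
    rw [Finset.sum_comm]
    refine Finset.sum_congr rfl fun u _ => ?_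
    rw [Finset.sum_comm]
    refine Finset.sum_congr rfl fun v _ => ?_
    simp [eq_comm]
  have h2 : ∀ u v : Fin n, (if σ u = σ v then (1 : ℝ) else 0) =
      (if u < v ∧ σ u = σ v then 1 else 0) + (if v < u ∧ σ v = σ u then 1 else 0) +
        if u = v then 1 else 0 := by
    intro u v
    rcases lt_trichotomy u v with h | h | h
    · simp [h, h.ne, h.not_gt]
    · simp [h]
    · simp [h, h.ne', h.not_gt, eq_comm]
  have h3 : ∑ u, ∑ v, (if u < v ∧ σ u = σ v then (1 : ℝ) else 0) = (monoPairs σ).card := by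
    rw [← Fintype.sum_prod_type' (f := fun u v => if u < v ∧ σ u = σ v then (1 : ℝ) else 0)]
    simp [monoPairs]
  rw [h1]
  simp only [h2, Finset.sum_add_distrib]
  rw [h3, Finset.sum_comm (f := fun u v => if v < u ∧ σ v = σ u then (1 : ℝ) else 0), h3]
  simp
  ring

/-- Summing the Bernoulli weights of the edge sets compatible with `σ`. -/
theorem sum_edges_compatible {n q : ℕ} (σ : Conf n q) (r : ℝ) :
    ∑ E ∈ (allPairs n).powerset with E ⊆ monoPairs σ,
      (1 - r) ^ E.card * r ^ ((allPairs n).card - E.card) =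
      r ^ ((allPairs n).card - (monoPairs σ).card) := by
  have hs := monoPairs_subset σ
  have hle := Finset.card_le_card hs
  have h1 : (allPairs n).powerset.filter (fun E => E ⊆ monoPairs σ) = (monoPairs σ).powerset := by
    ext E
    simp only [Finset.mem_filter, Finset.mem_powerset]
    exact ⟨fun h => h.2, fun h => ⟨h.trans hs, h⟩⟩
  rw [h1]
  have h2 := Finset.sum_pow_mul_eq_add_pow (1 - r) r (monoPairs σ)
  rw [sub_add_cancel, one_pow] at h2
  refine Eq.trans ?_ ((congrArg (fun x => r ^ ((allPairs n).card - (monoPairs σ).card) * x)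
    h2).trans (mul_one _))
  rw [Finset.mul_sum]
  refine Finset.sum_congr rfl fun E hE => ?_
  have := Finset.card_le_card (Finset.mem_powerset.1 hE)
  rw [show (allPairs n).card - E.card = ((allPairs n).card - (monoPairs σ).card) +
    ((monoPairs σ).card - E.card) by omega, pow_add]
  ring

/-- The Edwards–Sokal coupling of the random-cluster and Potts measures. -/
theorem edwards_sokal (n q : ℕ) (β : ℝ) : ∃ c : ℝ, 0 < c ∧ ∀ f : Conf n q → ℝ,
    ∑ E ∈ (allPairs n).powerset, (1 - Real.exp (-(β / n))) ^ E.card *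
      Real.exp (-(β / n)) ^ ((allPairs n).card - E.card) * ∑ σ with E ⊆ monoPairs σ, f σ =
    c * ∑ σ : Conf n q, Real.exp (β / (2 * n) * pottsEnergy σ) * f σ := by
  refine ⟨Real.exp (-(β / n)) ^ (allPairs n).card * Real.exp (-(β / (2 * n) * n)),
    by positivity, fun f => ?_⟩
  simp only [Finset.sum_filter, Finset.mul_sum, mul_ite, mul_zero]
  rw [Finset.sum_comm]
  refine Finset.sum_congr rfl fun σ _ => ?_
  rw [← Finset.sum_filter, ← Finset.sum_mul, sum_edges_compatible, ← mul_assoc]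
  congr 1
  have hle := Finset.card_le_card (monoPairs_subset σ)
  rw [← Real.exp_nat_mul, ← Real.exp_nat_mul, ← Real.exp_add, ← Real.exp_add, pottsEnergy_eq,
    Nat.cast_sub hle]
  congr 1
  rcases Nat.eq_zero_or_pos n with rfl | hn
  · simp
  · field_simp
    ring

theorem rcWeight_nonneg {q : ℕ} {β : ℝ} (hβ : 0 < β) {n : ℕ} (E : Finset (Fin n × Fin n)) :
    0 ≤ rcWeight n q β E := by
  have h : Real.exp (-(β / n)) ≤ 1 := Real.exp_le_one_iff.2 (neg_nonpos.2 (by positivity))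
  have h1 : 0 ≤ 1 - Real.exp (-(β / n)) := sub_nonneg.2 h
  rw [rcWeight]
  positivity

theorem sum_rcWeight_pos {q : ℕ} (hq : 2 ≤ q) {β : ℝ} (hβ : 0 < β) (n : ℕ) :
    0 < ∑ E ∈ (allPairs n).powerset, rcWeight n q β E := by
  refine Finset.sum_pos' (fun E _ => rcWeight_nonneg hβ E) ⟨∅, Finset.empty_mem_powerset _, ?_⟩
  have : 0 < (q : ℝ) := by positivity
  rw [rcWeight, Finset.card_empty, pow_zero, one_mul]
  positivity

/-- Second moment bound for the component sizes of the random-cluster measure. -/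
theorem rc_second_moment {q : ℕ} (hq : 2 ≤ q) {β : ℝ} (hβ : (q : ℝ) < β) {θ : ℝ}
    (hθ : θ = (aFix q β * q - 1) / ((q : ℝ) - 1)) :
    0 < θ ∧ ∃ C : ℝ, 0 < C ∧ ∃ N : ℕ, ∀ n : ℕ, N ≤ n →
      ∑ E ∈ (allPairs n).powerset, rcWeight n q β E *
        (((1 - 1 / q) * sumCompSq E - (1 - 1 / q) * θ ^ 2 * n ^ 2) ^ 2 +
          2 * (1 - 1 / q) / q * (sumCompSq E * (sumCompSq E - (L1 E : ℝ) ^ 2))) ≤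
      C * n ^ 3 * ∑ E ∈ (allPairs n).powerset, rcWeight n q β E := by
  subst hθ
  have hβ0 : 0 < β := lt_of_le_of_lt (Nat.cast_nonneg q) hβ
  obtain ⟨hθ0, C, hC, N, hN⟩ := potts_second_moment hq hβ
  refine ⟨hθ0, C, hC, N, fun n hn => ?_⟩
  set θ := (aFix q β * q - 1) / ((q : ℝ) - 1)
  obtain ⟨c, hc, hES⟩ := edwards_sokal n q β
  have h1 : 0 ≤ 1 - Real.exp (-(β / n)) :=
    sub_nonneg.2 (Real.exp_le_one_iff.2 (neg_nonpos.2 (by positivity)))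
  have hsum : ∑ E ∈ (allPairs n).powerset, rcWeight n q β E =
      c * ∑ σ : Conf n q, Real.exp (β / (2 * n) * pottsEnergy σ) := by
    have h := hES fun _ => 1
    simp only [mul_one] at h
    rw [← h]
    refine Finset.sum_congr rfl fun E hE => ?_
    rw [compatible_card (Finset.mem_powerset.1 hE), rcWeight]
  have hle := mul_le_mul_of_nonneg_left (hN n hn) hc.le
  have harg : (n : ℝ) ^ 2 * (1 / q + (1 - 1 / q) * θ ^ 2) =
      (n : ℝ) ^ 2 / q + (1 - 1 / q) * θ ^ 2 * n ^ 2 := by ring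
  rw [harg, ← hES] at hle
  rw [hsum, mul_left_comm]
  refine le_trans (Finset.sum_le_sum fun E hE => ?_) hle
  rw [rcWeight, mul_assoc]
  exact mul_le_mul_of_nonneg_left
    (compatible_second_moment_ge hq (Finset.mem_powerset.1 hE) _) (by positivity)

/-- Markov's inequality for a finite weighted sum. -/
theorem weighted_markov {ι : Type*} {s : Finset ι} {w G : ι → ℝ} {K : ℝ} (hK : 0 < K)
    (hw : ∀ i ∈ s, 0 ≤ w i) (hG : ∀ i ∈ s, 0 ≤ G i) (hpos : 0 < ∑ i ∈ s, w i)
    (h : ∑ i ∈ s, w i * G i ≤ K * ∑ i ∈ s, w i) :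
    (9 : ℝ) / 10 ≤ ∑ i ∈ s, if G i ≤ 10 * K then w i / ∑ i ∈ s, w i else 0 := by
  have h1 : 10 * K * (∑ i ∈ s, w i - ∑ i ∈ s, if G i ≤ 10 * K then w i else 0) ≤
      ∑ i ∈ s, w i * G i := by
    rw [← Finset.sum_sub_distrib, Finset.mul_sum]
    refine Finset.sum_le_sum fun i hi => ?_
    have := hw i hi
    have := hG i hi
    split_ifs with h2
    · rw [sub_self, mul_zero]
      positivity
    · rw [sub_zero, mul_comm]
      exact mul_le_mul_of_nonneg_left (not_le.1 h2).le (hw i hi)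
  have h2 : ∑ i ∈ s, (if G i ≤ 10 * K then w i / ∑ i ∈ s, w i else 0) =
      (∑ i ∈ s, if G i ≤ 10 * K then w i else 0) / ∑ i ∈ s, w i := by
    rw [Finset.sum_div]
    refine Finset.sum_congr rfl fun i _ => ?_
    rw [ite_div, zero_div]
  rw [h2, le_div_iff₀ hpos]
  have h3 : K * (10 * (∑ i ∈ s, w i - ∑ i ∈ s, if G i ≤ 10 * K then w i else 0)) ≤
      K * ∑ i ∈ s, w i := by linarith
  linarith [le_of_mul_le_mul_left h3 hK]

/-- Bounds on the largest component deduced from a bound on the second moment functional. -/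
theorem largest_bounds {θ c b B n T L : ℝ} (hθ : 0 < θ) (hc : 0 < c) (hb : 0 < b) (hB : 0 < B)
    (hn : 1 ≤ n) (hnB : 4 * B / (c ^ 2 * θ ^ 4) ≤ n) (hL : 0 ≤ L) (hLT : L ^ 2 ≤ T)
    (h : (c * T - c * θ ^ 2 * n ^ 2) ^ 2 + b * (T * (T - L ^ 2)) ≤ B * n ^ 3) :
    |L - θ * n| ≤ (Real.sqrt B / c + 2 * B / (b * θ ^ 2)) / θ * Real.sqrt n ∧
      T - L ^ 2 ≤ 2 * B / (b * θ ^ 2) * n := by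
  have hn0 : 0 < n := by linarith
  have hT0 : 0 ≤ T := (sq_nonneg L).trans hLT
  have hTL : 0 ≤ T - L ^ 2 := sub_nonneg.2 hLT
  set s := Real.sqrt n with hs
  have hs1 : 1 ≤ s := Real.one_le_sqrt.2 hn
  have hss : s ^ 2 = n := Real.sq_sqrt hn0.le
  have hBB : Real.sqrt B ^ 2 = B := Real.sq_sqrt hB.le
  have h1 : (c * T - c * θ ^ 2 * n ^ 2) ^ 2 ≤ B * n ^ 3 := by
    have : 0 ≤ b * (T * (T - L ^ 2)) := by positivity
    linarith
  have h2 : b * (T * (T - L ^ 2)) ≤ B * n ^ 3 := by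
    linarith [sq_nonneg (c * T - c * θ ^ 2 * n ^ 2)]
  have hdev : |T - θ ^ 2 * n ^ 2| ≤ Real.sqrt B / c * (n * s) := by
    apply abs_le_of_sq_le_sq _ (by positivity)
    have e1 : (Real.sqrt B / c * (n * s)) ^ 2 = B * n ^ 3 / c ^ 2 := by
      rw [mul_pow, div_pow, hBB, mul_pow, hss]
      ring
    rw [e1, le_div_iff₀ (by positivity)]
    linarith
  have hTlow : θ ^ 2 * n ^ 2 / 2 ≤ T := by
    have h3 : |T - θ ^ 2 * n ^ 2| ≤ θ ^ 2 * n ^ 2 / 2 := by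
      apply abs_le_of_sq_le_sq _ (by positivity)
      rw [div_le_iff₀ (by positivity)] at hnB
      have h4 := mul_le_mul_of_nonneg_right hnB (show 0 ≤ n ^ 3 by positivity)
      have h5 : c ^ 2 * (T - θ ^ 2 * n ^ 2) ^ 2 ≤ c ^ 2 * (θ ^ 2 * n ^ 2 / 2) ^ 2 := by
        linarith
      exact le_of_mul_le_mul_left h5 (by positivity)
    linarith [(abs_le.1 h3).1]
  have hsecond : T - L ^ 2 ≤ 2 * B / (b * θ ^ 2) * n := by
    have h3 : b * (θ ^ 2 * n ^ 2 / 2 * (T - L ^ 2)) ≤ B * n ^ 3 := by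
      refine le_trans ?_ h2
      gcongr
    rw [div_mul_eq_mul_div, le_div_iff₀ (by positivity)]
    have h4 : n ^ 2 * ((T - L ^ 2) * (b * θ ^ 2)) ≤ n ^ 2 * (2 * B * n) := by linarith
    exact le_of_mul_le_mul_left h4 (by positivity)
  refine ⟨?_, hsecond⟩
  have hL2 : |L ^ 2 - θ ^ 2 * n ^ 2| ≤ (Real.sqrt B / c + 2 * B / (b * θ ^ 2)) * (n * s) := by
    have h3 : 2 * B / (b * θ ^ 2) * n ≤ 2 * B / (b * θ ^ 2) * (n * s) :=
      mul_le_mul_of_nonneg_left (le_mul_of_one_le_right hn0.le hs1) (by positivity)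
    rw [abs_le] at hdev ⊢
    constructor <;> linarith
  have h4 : |L - θ * n| * (θ * n) ≤ |L ^ 2 - θ ^ 2 * n ^ 2| := by
    rw [show L ^ 2 - θ ^ 2 * n ^ 2 = (L - θ * n) * (L + θ * n) by ring, abs_mul,
      abs_of_nonneg (show 0 ≤ L + θ * n by positivity)]
    exact mul_le_mul_of_nonneg_left (by linarith) (abs_nonneg _)
  rw [div_mul_eq_mul_div, le_div_iff₀ hθ]
  have h5 := h4.trans hL2
  have h6 : n * (|L - θ * n| * θ) ≤
      n * ((Real.sqrt B / c + 2 * B / (b * θ ^ 2)) * s) := by linarith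
  exact le_of_mul_le_mul_left h6 hn0

/-- Lemma B.1: under the mean-field random-cluster measure with
parameters `q` and `p = 1 - e^{-β/n}`, with probability at least `0.9`, both
`|L₁(A) - θ n| ≤ γ₀ √n` (where `θ = (aq-1)/(q-1)`) and `Σ_{i≥2} L_i(A)² ≤ γ₁ n`. -/
theorem rc_concentration (q : ℕ) (hq : 2 ≤ q) (β : ℝ) (hβ : (q : ℝ) < β) :
    ∃ γ₀ γ₁ : ℝ, 0 < γ₀ ∧ 0 < γ₁ ∧ ∃ N : ℕ, ∀ n : ℕ, N ≤ n →
      (9 : ℝ) / 10 ≤ ∑ E ∈ (allPairs n).powerset,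
        (if |(L1 E : ℝ) - (aFix q β * q - 1) / ((q : ℝ) - 1) * n| ≤ γ₀ * Real.sqrt n ∧
            (sumCompSq E : ℝ) - (L1 E : ℝ) ^ 2 ≤ γ₁ * n
          then rcProb n q β E else 0) := by
  have hq2 : (2 : ℝ) ≤ q := by exact_mod_cast hq
  have hβ0 : 0 < β := by linarith
  obtain ⟨hθ, C, hC, N, hN⟩ := rc_second_moment hq hβ rfl
  set θ := (aFix q β * q - 1) / ((q : ℝ) - 1)
  have hc : 0 < 1 - 1 / (q : ℝ) := by
    rw [sub_pos, div_lt_one (by positivity)]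
    linarith
  set c := 1 - 1 / (q : ℝ)
  have hb : 0 < 2 * c / q := by positivity
  set b := 2 * c / (q : ℝ)
  refine ⟨(Real.sqrt (10 * C) / c + 2 * (10 * C) / (b * θ ^ 2)) / θ,
    2 * (10 * C) / (b * θ ^ 2), by positivity, by positivity,
    max N ⌈max 1 (4 * (10 * C) / (c ^ 2 * θ ^ 4))⌉₊, fun n hn => ?_⟩
  have hn2 := Nat.le_of_ceil_le ((le_max_right _ _).trans hn)
  have hn1 : (1 : ℝ) ≤ n := (le_max_left _ _).trans hn2
  have hnB : 4 * (10 * C) / (c ^ 2 * θ ^ 4) ≤ n := (le_max_right _ _).trans hn2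
  have hn0 : (0 : ℝ) < n := by linarith
  have hmarkov := weighted_markov (K := C * n ^ 3) (by positivity)
    (fun E _ => rcWeight_nonneg (q := q) hβ0 E)
    (fun E _ => by
      have := sub_nonneg.2 (L1_sq_le_sumCompSq E)
      positivity) (sum_rcWeight_pos hq hβ0 n) (hN n ((le_max_left _ _).trans hn))
  refine hmarkov.trans (Finset.sum_le_sum fun E _ => ?_)
  have hprob : 0 ≤ rcProb n q β E :=
    div_nonneg (rcWeight_nonneg hβ0 E) (sum_rcWeight_pos hq hβ0 n).le
  split_ifs with h1 h2 h2
  · exact le_rfl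
  · exact absurd (largest_bounds hθ hc hb (by positivity) hn1 hnB (Nat.cast_nonneg _)
      (L1_sq_le_sumCompSq E) (by linarith)) h2
  · exact hprob
  · exact le_rfl
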